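/- arXiv:1901.07671 — 4 statements merged into one kernel-verified Lean document; each statement's English description precedes it below -/
import Mathlib

section
/- Let n ≥ 1 and let u be a non-constant solution of the Allen–Cahn equation −Δu = u − u³ on ℝⁿ. If the zero level set {u = 0} is contained in a slab {x ∈ ℝⁿ : |x·e| < A} for some unit vector e ∈ ℝⁿ and some real number A > 0, then there exists a real number a such that either u(x) = H(−x·e + a) for all x ∈ ℝⁿ, or u(x) = H(x·e + a) for all x ∈ ℝⁿ. -/
open scoped RealInnerProductSpace

noncomputable def laplacian {n : ℕ} (u : EuclideanSpace ℝ (Fin n) → ℝ)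
    (x : EuclideanSpace ℝ (Fin n)) : ℝ :=
  ∑ i : Fin n, fderiv ℝ (fun y => fderiv ℝ u y (EuclideanSpace.single i 1)) x
    (EuclideanSpace.single i 1)

def IsACSolution {n : ℕ} (u : EuclideanSpace ℝ (Fin n) → ℝ) : Prop :=
  ContDiff ℝ 2 u ∧ ∀ x, -laplacian u x = u x - (u x) ^ 3

noncomputable def H (t : ℝ) : ℝ := Real.tanh (t / Real.sqrt 2)

open Filter Topology

lemma snd_le_zero {g g' : ℝ → ℝ} {p : ℝ} (h1 : ∀ᶠ t in 𝓝 (0:ℝ), HasDerivAt g (g' t) t)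
    (h2 : HasDerivAt g' p 0) (hmax : IsLocalMax g 0) : p ≤ 0 := by
  by_contra hp
  push Not at hp
  have e1 : deriv g =ᶠ[𝓝 0] g' := h1.mono fun t ht => ht.deriv
  have e2 : deriv (deriv g) 0 = p := by rw [e1.deriv_eq, h2.deriv]
  have e3 : deriv g 0 = 0 := hmax.deriv_eq_zero
  have hmin : IsLocalMin g 0 := isLocalMin_of_deriv_deriv_pos (by rw [e2]; exact hp) e3
    h1.self_of_nhds.continuousAt
  have hc : g =ᶠ[𝓝 0] fun _ => g 0 := by
    filter_upwards [hmin, hmax] with t h3 h4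
    exact le_antisymm h4 h3
  have h5 : deriv g =ᶠ[𝓝 0] fun _ => 0 := by
    have := hc.deriv
    simpa using this
  have h6 : deriv (deriv g) 0 = 0 := by rw [h5.deriv_eq]; simp
  rw [e2] at h6
  exact hp.ne' h6

abbrev EE (n : ℕ) := EuclideanSpace ℝ (Fin n)

lemma line_deriv1 {n : ℕ} {w : EE n → ℝ} (hw : ContDiff ℝ 2 w) (x v : EE n) (t : ℝ) :
    HasDerivAt (fun t : ℝ => w (x + t • v)) (fderiv ℝ w (x + t • v) v) t := by
  have h1 : HasFDerivAt w (fderiv ℝ w (x + t • v)) (x + t • v) :=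
    (hw.differentiable (by norm_num) _).hasFDerivAt
  have h2 : HasDerivAt (fun t : ℝ => x + t • v) v t := by
    simpa using ((hasDerivAt_id t).smul_const v).const_add x
  exact h1.comp_hasDerivAt t h2

lemma fderiv_dir_contDiff {n : ℕ} {w : EE n → ℝ} (hw : ContDiff ℝ 2 w) (v : EE n) :
    ContDiff ℝ 1 (fun y => fderiv ℝ w y v) :=
  (hw.fderiv_right (m := 1) (by norm_num)).clm_apply contDiff_const

lemma line_deriv2 {n : ℕ} {w : EE n → ℝ} (hw : ContDiff ℝ 2 w) (x v : EE n) :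
    HasDerivAt (fun t : ℝ => fderiv ℝ w (x + t • v) v)
      (fderiv ℝ (fun y => fderiv ℝ w y v) x v) 0 := by
  have h1 : HasFDerivAt (fun y => fderiv ℝ w y v) (fderiv ℝ (fun y => fderiv ℝ w y v) x)
      (x + (0:ℝ) • v) := by
    have := ((fderiv_dir_contDiff hw v).differentiable (by norm_num) x).hasFDerivAt
    simpa using this
  have h2 : HasDerivAt (fun t : ℝ => x + t • v) v 0 := by
    simpa using ((hasDerivAt_id (0:ℝ)).smul_const v).const_add x
  exact h1.comp_hasDerivAt (0:ℝ) h2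

lemma lap_le {n : ℕ} {w : EE n → ℝ} (hw : ContDiff ℝ 2 w) (x : EE n)
    (ψ ψ' : Fin n → ℝ → ℝ) (p : Fin n → ℝ)
    (h1 : ∀ i, ∀ᶠ t in 𝓝 (0:ℝ), HasDerivAt (ψ i) (ψ' i t) t)
    (h2 : ∀ i, HasDerivAt (ψ' i) (p i) 0)
    (h3 : ∀ i, ∀ᶠ t in 𝓝 (0:ℝ), w (x + t • EuclideanSpace.single i 1) - ψ i t ≤ w x - ψ i 0) :
    laplacian w x ≤ ∑ i, p i := by
  unfold laplacian
  apply Finset.sum_le_sum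
  intro i _
  have := snd_le_zero (g := fun t => w (x + t • EuclideanSpace.single i 1) - ψ i t)
    (g' := fun t => fderiv ℝ w (x + t • EuclideanSpace.single i 1) (EuclideanSpace.single i 1) - ψ' i t)
    ((h1 i).mono fun t ht => (line_deriv1 hw x _ t).sub ht)
    ((line_deriv2 hw x _).sub (h2 i))
    ((h3 i).mono fun t ht => by simpa using ht)
  linarith

lemma normsq_line {n : ℕ} (d : EE n) (i : Fin n) (t : ℝ) :
    ‖d + t • EuclideanSpace.single i (1:ℝ)‖ ^ 2 = ‖d‖ ^ 2 + (2 * d i * t + t ^ 2) := by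
  rw [norm_add_sq_real, norm_smul, inner_smul_right, EuclideanSpace.inner_single_right]
  simp
  ring

lemma tendsto_line {n : ℕ} (x v : EE n) :
    Tendsto (fun t : ℝ => x + t • v) (𝓝 0) (𝓝 x) := by
  have : Continuous (fun t : ℝ => x + t • v) := by fun_prop
  simpa using this.tendsto 0

lemma lap_le_radial {n : ℕ} {w : EE n → ℝ} (hw : ContDiff ℝ 2 w) (x c : EE n)
    (F F' : ℝ → ℝ) (F'' : ℝ)
    (h1 : ∀ᶠ s in 𝓝 (‖x - c‖ ^ 2), HasDerivAt F (F' s) s)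
    (h2 : HasDerivAt F' F'' (‖x - c‖ ^ 2))
    (h3 : ∀ᶠ y in 𝓝 x, w y - F (‖y - c‖ ^ 2) ≤ w x - F (‖x - c‖ ^ 2)) :
    laplacian w x ≤ 4 * ‖x - c‖ ^ 2 * F'' + 2 * n * F' (‖x - c‖ ^ 2) := by
  set d := x - c with hd
  have hq : ∀ (i : Fin n) (t : ℝ), HasDerivAt (fun t : ℝ => ‖d‖ ^ 2 + (2 * d i * t + t ^ 2))
      (2 * d i + 2 * t) t := by
    intro i t
    have := (((hasDerivAt_id t).const_mul (2 * d i)).add ((hasDerivAt_id t).pow 2)).const_add (‖d‖^2)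
    refine HasDerivAt.congr_deriv this ?_
    simp
  have key := lap_le hw x (fun i t => F (‖d‖ ^ 2 + (2 * d i * t + t ^ 2)))
    (fun i t => F' (‖d‖ ^ 2 + (2 * d i * t + t ^ 2)) * (2 * d i + 2 * t))
    (fun i => F'' * (2 * d i) * (2 * d i) + F' (‖d‖ ^ 2) * 2) ?_ ?_ ?_
  · refine key.trans (le_of_eq ?_)
    rw [Finset.sum_add_distrib, EuclideanSpace.real_norm_sq_eq]
    simp only [Finset.sum_const, Finset.card_univ, Fintype.card_fin, nsmul_eq_mul]
    rw [Finset.mul_sum, Finset.sum_mul]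
    congr 1
    · apply Finset.sum_congr rfl; intros; ring
    · ring
  · intro i
    have ht : Tendsto (fun t : ℝ => ‖d‖ ^ 2 + (2 * d i * t + t ^ 2)) (𝓝 0) (𝓝 (‖d‖ ^ 2)) := by
      have := (hq i 0).continuousAt.tendsto
      simpa using this
    filter_upwards [ht.eventually h1] with t h
    exact h.comp t (hq i t)
  · intro i
    have h2' : HasDerivAt F' F'' (‖d‖ ^ 2 + (2 * d i * 0 + 0 ^ 2)) := by simpa using h2
    have a1 := h2'.comp (0:ℝ) (hq i 0)
    have a2 : HasDerivAt (fun t : ℝ => 2 * d i + 2 * t) 2 0 := by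
      simpa using ((hasDerivAt_id (0:ℝ)).const_mul 2).const_add (2 * d i)
    refine HasDerivAt.congr_deriv (a1.mul a2) ?_
    simp
  · intro i
    filter_upwards [(tendsto_line x (EuclideanSpace.single i 1)).eventually h3] with t ht
    have e1 : x + t • EuclideanSpace.single i (1:ℝ) - c = d + t • EuclideanSpace.single i (1:ℝ) := by
      rw [hd]; abel
    rw [e1, normsq_line] at ht
    simpa using ht

lemma laplacian_neg' {n : ℕ} (w : EE n → ℝ) (x : EE n) :
    laplacian (fun y => - w y) x = - laplacian w x := by
  unfold laplacian
  rw [← Finset.sum_neg_distrib]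
  apply Finset.sum_congr rfl
  intro i _
  simp [fderiv_fun_neg]

lemma laplacian_sub' {n : ℕ} {w v : EE n → ℝ} (hw : ContDiff ℝ 2 w) (hv : ContDiff ℝ 2 v)
    (x : EE n) :
    laplacian (fun y => w y - v y) x = laplacian w x - laplacian v x := by
  unfold laplacian
  rw [← Finset.sum_sub_distrib]
  apply Finset.sum_congr rfl
  intro i _
  have h : (fun y => fderiv ℝ (fun y => w y - v y) y (EuclideanSpace.single i 1)) =
      fun y => fderiv ℝ w y (EuclideanSpace.single i 1) - fderiv ℝ v y (EuclideanSpace.single i 1) := by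
    funext y
    rw [fderiv_fun_sub (hw.differentiable (by norm_num) _) (hv.differentiable (by norm_num) _)]
    rfl
  rw [h, fderiv_fun_sub ((fderiv_dir_contDiff hw _).differentiable (by norm_num) _)
    ((fderiv_dir_contDiff hv _).differentiable (by norm_num) _)]
  rfl

lemma laplacian_shift {n : ℕ} (w : EE n → ℝ) (a x : EE n) :
    laplacian (fun y => w (y + a)) x = laplacian w (x + a) := by
  unfold laplacian
  apply Finset.sum_congr rfl
  intro i _
  simp only [fderiv_comp_add_right]
  rw [fderiv_comp_add_right (f := fun y => fderiv ℝ w y (EuclideanSpace.single i 1))]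

lemma lap_ge_radial {n : ℕ} {w : EE n → ℝ} (hw : ContDiff ℝ 2 w) (x c : EE n)
    (F F' : ℝ → ℝ) (F'' : ℝ)
    (h1 : ∀ᶠ s in 𝓝 (‖x - c‖ ^ 2), HasDerivAt F (F' s) s)
    (h2 : HasDerivAt F' F'' (‖x - c‖ ^ 2))
    (h3 : ∀ᶠ y in 𝓝 x, w x - F (‖x - c‖ ^ 2) ≤ w y - F (‖y - c‖ ^ 2)) :
    4 * ‖x - c‖ ^ 2 * F'' + 2 * n * F' (‖x - c‖ ^ 2) ≤ laplacian w x := by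
  have := lap_le_radial (w := fun y => - w y) hw.neg x c (fun s => - F s) (fun s => - F' s) (-F'')
    (h1.mono fun s hs => hs.neg) h2.neg (h3.mono fun y hy => by linarith)
  rw [laplacian_neg'] at this
  linarith

lemma ac_neg {n : ℕ} {u : EE n → ℝ} (hu : IsACSolution u) : IsACSolution (fun y => - u y) := by
  refine ⟨hu.1.neg, fun x => ?_⟩
  rw [laplacian_neg']
  have := hu.2 x
  linear_combination -this

lemma ac_shift {n : ℕ} {u : EE n → ℝ} (hu : IsACSolution u) (a : EE n) :
    IsACSolution (fun y => u (y + a)) := by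
  refine ⟨hu.1.comp (contDiff_id.add contDiff_const), fun x => ?_⟩
  rw [laplacian_shift]
  exact hu.2 _

lemma ac_lap {n : ℕ} {u : EE n → ℝ} (hu : IsACSolution u) (x : EE n) :
    laplacian u x = u x ^ 3 - u x := by
  have := hu.2 x
  linarith

lemma ac_le_one {n : ℕ} {u : EE n → ℝ} (hu : IsACSolution u) (x0 : EE n) : u x0 ≤ 1 := by
  by_contra hcon
  push Not at hcon
  obtain ⟨δ, hδ⟩ : ∃ δ, δ = u x0 - 1 := ⟨_, rfl⟩
  have hδ0 : 0 < δ := by linarith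
  obtain ⟨R, hRd⟩ : ∃ R : ℝ, R = (2 * n + 9) / δ := ⟨_, rfl⟩
  have hR : 0 < R := by rw [hRd]; positivity
  have hδR : δ * R = 2 * n + 9 := by rw [hRd]; field_simp
  have hcont : Continuous fun y => (u y - 1) * (R ^ 2 - ‖y - x0‖ ^ 2) := by
    have := hu.1.continuous
    fun_prop
  obtain ⟨x, hx, hmax⟩ := (isCompact_closedBall x0 R).exists_isMaxOn
    ⟨x0, Metric.mem_closedBall_self hR.le⟩ hcont.continuousOn
  obtain ⟨K, hK⟩ : ∃ K, K = (u x - 1) * (R ^ 2 - ‖x - x0‖ ^ 2) := ⟨_, rfl⟩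
  have hKge : δ * R ^ 2 ≤ K := by
    have := hmax (Metric.mem_closedBall_self hR.le)
    simp only [Set.mem_ofPred_eq, sub_self, norm_zero] at this
    rw [← hδ, ← hK] at this
    simpa using this
  have hKpos : 0 < K := lt_of_lt_of_le (by positivity) hKge
  have hxR : ‖x - x0‖ ≤ R := by simpa [dist_eq_norm] using hx
  obtain ⟨s, hs⟩ : ∃ s, s = ‖x - x0‖ ^ 2 := ⟨_, rfl⟩
  have hs0 : 0 ≤ s := by rw [hs]; positivity
  have hsR : s ≤ R ^ 2 := by rw [hs]; gcongr
  obtain ⟨D, hD⟩ : ∃ D, D = R ^ 2 - s := ⟨_, rfl⟩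
  rw [← hs, ← hD] at hK
  have hDpos : 0 < D := by
    rcases (show 0 ≤ D by linarith).eq_or_lt with h | h
    · rw [← h] at hK; simp at hK; linarith
    · exact h
  have hxlt : ‖x - x0‖ < R := by
    apply lt_of_pow_lt_pow_left₀ 2 hR.le
    linarith
  have key := lap_le_radial hu.1 x x0 (fun s => K / (R ^ 2 - s)) (fun s => K / (R ^ 2 - s) ^ 2)
    (2 * K / (R ^ 2 - s) ^ 3) ?_ ?_ ?_
  · rw [ac_lap hu, ← hs, ← hD] at key
    have hu1 : u x = 1 + K / D := by rw [hK]; field_simp; ring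
    have hq : 0 < K / D := by positivity
    have h1 : (K / D) ^ 3 ≤ u x ^ 3 - u x := by
      rw [hu1]; nlinarith [sq_nonneg (K / D)]
    have h2 : (K / D) ^ 3 ≤ 4 * s * (2 * K / D ^ 3) + 2 * n * (K / D ^ 2) := h1.trans key
    have h3 : K ^ 3 ≤ 8 * s * K + 2 * n * K * D := by
      have := mul_le_mul_of_nonneg_right h2 (show 0 ≤ D ^ 3 by positivity)
      field_simp at this
      nlinarith
    have h4 : K ^ 2 ≤ 8 * s + 2 * n * D := by
      have : K * K ^ 2 ≤ K * (8 * s + 2 * n * D) := by linarith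
      exact le_of_mul_le_mul_left this hKpos
    have hn : (0:ℝ) ≤ n := Nat.cast_nonneg n
    have h5 : K ^ 2 ≤ (8 + 2 * n) * R ^ 2 := by
      nlinarith [mul_nonneg hn hs0]
    have h6 : (δ * R ^ 2) ^ 2 ≤ K ^ 2 := by gcongr
    have h7 : (2 * n + 9 : ℝ) ^ 2 * R ^ 2 ≤ (8 + 2 * n) * R ^ 2 := by
      rw [← hδR]; linarith [show (δ * R ^ 2) ^ 2 = (δ * R) ^ 2 * R ^ 2 by ring]
    have h8 := le_of_mul_le_mul_right h7 (by positivity : 0 < R ^ 2)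
    nlinarith
  · rw [← hs]
    have : ∀ᶠ t in 𝓝 s, t < R ^ 2 := eventually_lt_nhds (by linarith)
    filter_upwards [this] with t ht
    have h0 : R ^ 2 - t ≠ 0 := by linarith
    have := ((hasDerivAt_id t).const_sub (R ^ 2)).inv h0 |>.const_mul K
    refine HasDerivAt.congr_deriv this ?_
    simp [div_eq_mul_inv]
  · rw [← hs]
    have h0 : R ^ 2 - s ≠ 0 := by linarith
    have := (((hasDerivAt_id s).const_sub (R ^ 2)).pow 2).inv (pow_ne_zero 2 h0) |>.const_mul K
    refine HasDerivAt.congr_deriv this ?_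
    simp
    field_simp
  · have hopen : ∀ᶠ y in 𝓝 x, y ∈ Metric.ball x0 R :=
      Metric.isOpen_ball.eventually_mem (by simpa [dist_eq_norm] using hxlt)
    filter_upwards [hopen] with y hy
    have hy1 := hmax (Metric.ball_subset_closedBall hy)
    simp only [Set.mem_ofPred_eq] at hy1
    rw [← hs, ← hD, ← hK] at hy1
    have hy2 : ‖y - x0‖ < R := by simpa [dist_eq_norm] using hy
    have hy3 : 0 < R ^ 2 - ‖y - x0‖ ^ 2 := by
      have : ‖y - x0‖ ^ 2 < R ^ 2 := by gcongr
      linarith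
    have hy4 : u y - 1 ≤ K / (R ^ 2 - ‖y - x0‖ ^ 2) := by rwa [le_div_iff₀ hy3]
    rw [← hs, ← hD]
    have hu1 : u x = 1 + K / D := by rw [hK]; field_simp; ring
    rw [hu1]; linarith

lemma ac_ge_neg_one {n : ℕ} {u : EE n → ℝ} (hu : IsACSolution u) (x : EE n) : -1 ≤ u x := by
  have := ac_le_one (ac_neg hu) x
  linarith

lemma exists_penal_max {n : ℕ} {W : EE n → ℝ} (hW : Continuous W) {S : Set (EE n)}
    (hS : IsClosed S) {x0 : EE n} (hx0 : x0 ∈ S) {M : ℝ} (hM : ∀ y ∈ S, W y ≤ M)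
    {ε : ℝ} (hε : 0 < ε) :
    ∃ x ∈ S, ∀ y ∈ S, W y - ε * ‖y - x0‖ ^ 2 ≤ W x - ε * ‖x - x0‖ ^ 2 := by
  have h0 : W x0 ≤ M := hM _ hx0
  obtain ⟨ρ, hρd⟩ : ∃ ρ, ρ = Real.sqrt ((M - W x0) / ε) := ⟨_, rfl⟩
  have hρ2 : ε * ρ ^ 2 = M - W x0 := by
    rw [hρd, Real.sq_sqrt (div_nonneg (by linarith) hε.le)]; field_simp
  have hρ : 0 ≤ ρ := by rw [hρd]; positivity
  have hcont : Continuous fun y => W y - ε * ‖y - x0‖ ^ 2 := by fun_prop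
  obtain ⟨x, hx, hmax⟩ := ((isCompact_closedBall x0 ρ).inter_right hS).exists_isMaxOn
    ⟨x0, Metric.mem_closedBall_self hρ, hx0⟩ hcont.continuousOn
  refine ⟨x, hx.2, fun y hy => ?_⟩
  by_cases hb : ‖y - x0‖ ≤ ρ
  · exact hmax ⟨by simpa [dist_eq_norm] using hb, hy⟩
  · push Not at hb
    have h1 := hmax ⟨Metric.mem_closedBall_self hρ, hx0⟩
    simp only [Set.mem_ofPred_eq, sub_self, norm_zero] at h1
    have h2 : ε * ρ ^ 2 ≤ ε * ‖y - x0‖ ^ 2 := by gcongr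
    have := hM y hy
    nlinarith

lemma mp_global {n : ℕ} {W : EE n → ℝ} (hW : ContDiff ℝ 2 W) {M c : ℝ} (hM : ∀ y, W y ≤ M)
    (hc : 0 < c) (hsub : ∀ x, 0 < W x → c * W x ≤ laplacian W x) (x0 : EE n) : W x0 ≤ 0 := by
  by_contra hcon
  push Not at hcon
  obtain ⟨ε, hεd⟩ : ∃ ε, ε = c * W x0 / (2 * n + 1) := ⟨_, rfl⟩
  have hε : 0 < ε := by rw [hεd]; positivity
  obtain ⟨x, -, hx⟩ := exists_penal_max hW.continuous isClosed_univ (Set.mem_univ x0)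
    (fun y _ => hM y) hε
  have h1 := hx x0 (Set.mem_univ _)
  simp only [sub_self, norm_zero] at h1
  have h2 : W x0 ≤ W x := by
    have : 0 ≤ ε * ‖x - x0‖ ^ 2 := by positivity
    nlinarith
  have key := lap_le_radial hW x x0 (fun s => ε * s) (fun _ => ε) 0
    (Eventually.of_forall fun s => by simpa using (hasDerivAt_id s).const_mul ε)
    (hasDerivAt_const _ _) (Eventually.of_forall fun y => hx y (Set.mem_univ _))
  have h3 := hsub x (by linarith)
  have h4 : c * W x0 ≤ c * W x := by gcongr
  have h5 : ε * (2 * n + 1) = c * W x0 := by rw [hεd]; field_simp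
  linarith

lemma ac_lower {n : ℕ} {u : EE n → ℝ} (hu : IsACSolution u) (y0 : EE n)
    (hpos : ∀ x ∈ Metric.closedBall y0 (8 + 4 * (n:ℝ)), 0 < u x) : 4 / 5 ≤ u y0 := by
  by_contra hcon
  push Not at hcon
  obtain ⟨R, hRd⟩ : ∃ R : ℝ, R = 8 + 4 * (n:ℝ) := ⟨_, rfl⟩
  rw [← hRd] at hpos
  have hR : 0 < R := by rw [hRd]; positivity
  have hmem : y0 ∈ Metric.closedBall y0 R := Metric.mem_closedBall_self hR.le
  have hcont : ContinuousOn (fun y => (1 - ‖y - y0‖ ^ 2 / R ^ 2) ^ 2 / u y) (Metric.closedBall y0 R) := by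
    apply ContinuousOn.div
    · fun_prop
    · exact hu.1.continuous.continuousOn
    · intro x hx; exact (hpos x hx).ne'
  obtain ⟨x, hx, hmax⟩ := (isCompact_closedBall y0 R).exists_isMaxOn ⟨y0, hmem⟩ hcont
  obtain ⟨q, hq⟩ : ∃ q, q = (1 - ‖x - y0‖ ^ 2 / R ^ 2) ^ 2 / u x := ⟨_, rfl⟩
  have hqge : 1 / u y0 ≤ q := by
    have := hmax hmem
    simpa [← hq] using this
  have hu0 := hpos _ hmem
  have hux := hpos _ hx
  have hqpos : 0 < q := lt_of_lt_of_le (by positivity) hqge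
  have hq54 : 5 / 4 < q := by
    refine lt_of_lt_of_le ?_ hqge
    rw [lt_div_iff₀ hu0]; linarith
  have hxR : ‖x - y0‖ ≤ R := by simpa [dist_eq_norm] using hx
  obtain ⟨s, hs⟩ : ∃ s, s = ‖x - y0‖ ^ 2 := ⟨_, rfl⟩
  have hs0 : 0 ≤ s := by rw [hs]; positivity
  have hsR : s ≤ R ^ 2 := by rw [hs]; gcongr
  obtain ⟨d, hd⟩ : ∃ d, d = 1 - s / R ^ 2 := ⟨_, rfl⟩
  have hsd : s = R ^ 2 * (1 - d) := by rw [hd]; field_simp; ring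
  rw [← hs, ← hd] at hq
  have hd1 : d ≤ 1 := by rw [hd]; have : 0 ≤ s / R ^ 2 := by positivity
                         linarith
  have hd0 : 0 ≤ d := by
    rw [hd]; have : s / R ^ 2 ≤ 1 := by rw [div_le_one (by positivity)]; exact hsR
    linarith
  have hdpos : 0 < d := by
    rcases hd0.eq_or_lt with h | h
    · rw [← h] at hq; simp at hq; linarith
    · exact h
  have hxlt : ‖x - y0‖ < R := by
    apply lt_of_pow_lt_pow_left₀ 2 hR.le
    rw [← hs, hsd]
    have : 0 < R ^ 2 * d := by positivity
    linarith
  obtain ⟨κ, hκ⟩ : ∃ κ, κ = 1 / q := ⟨_, rfl⟩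
  have hκpos : 0 < κ := by rw [hκ]; positivity
  have hκ45 : κ < 4 / 5 := by rw [hκ, div_lt_iff₀ hqpos]; linarith
  have hκq : κ * q = 1 := by rw [hκ]; field_simp
  have hueq : u x = κ * d ^ 2 := by
    have : q * u x = d ^ 2 := by rw [hq]; field_simp
    rw [← this, ← mul_assoc, hκq, one_mul]
  have key := lap_ge_radial hu.1 x y0 (fun s => κ * (1 - s / R ^ 2) ^ 2)
    (fun s => κ * (2 * (1 - s / R ^ 2) * (-(1 / R ^ 2))))
    (κ * (2 * (-(1 / R ^ 2)) * (-(1 / R ^ 2)))) ?_ ?_ ?_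
  · rw [ac_lap hu, ← hs, ← hd, hueq] at key
    have e1 : 4 * s * (κ * (2 * (-(1 / R ^ 2)) * (-(1 / R ^ 2)))) + 2 * n * (κ * (2 * d * (-(1 / R ^ 2))))
        = κ * ((8 * (1 - d) - 4 * n * d) / R ^ 2) := by
      rw [hsd]; field_simp; ring
    rw [e1] at key
    have e2 : (κ * d ^ 2) ^ 3 - κ * d ^ 2 = κ * (d ^ 2 * ((κ * d ^ 2) ^ 2 - 1)) := by ring
    rw [e2] at key
    have k2 := le_of_mul_le_mul_left key hκpos
    rw [div_le_iff₀ (by positivity)] at k2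
    have h1 : κ * d ^ 2 ≤ 4 / 5 := by
      have : d ^ 2 ≤ 1 := by nlinarith
      nlinarith
    have h2 : (κ * d ^ 2) ^ 2 - 1 ≤ - (9 / 25) := by
      have : 0 ≤ κ * d ^ 2 := by positivity
      nlinarith
    have h3 : d ^ 2 * ((κ * d ^ 2) ^ 2 - 1) * R ^ 2 ≤ d ^ 2 * (-(9/25)) * R ^ 2 := by gcongr
    have h4 : 8 * (1 - d) - 4 * n * d = 8 - R * d := by rw [hRd]; ring
    rw [h4] at k2
    nlinarith [sq_nonneg (R * d - 2), sq_nonneg (R * d)]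
  · refine Eventually.of_forall fun t => ?_
    have := ((((hasDerivAt_id t).div_const (R ^ 2)).const_sub 1).pow 2).const_mul κ
    refine HasDerivAt.congr_deriv this ?_
    simp
  · have := (((((hasDerivAt_id (‖x - y0‖ ^ 2)).div_const (R ^ 2)).const_sub 1).const_mul 2).mul_const
      (-(1 / R ^ 2))).const_mul κ
    exact this
  · have hopen : ∀ᶠ y in 𝓝 x, y ∈ Metric.ball y0 R :=
      Metric.isOpen_ball.eventually_mem (by simpa [dist_eq_norm] using hxlt)
    filter_upwards [hopen] with y hy
    have hyc := Metric.ball_subset_closedBall hy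
    have hy1 := hmax hyc
    simp only [Set.mem_ofPred_eq] at hy1
    rw [← hs, ← hd, ← hq, div_le_iff₀ (hpos y hyc)] at hy1
    rw [← hs, ← hd, hueq]
    have := mul_le_mul_of_nonneg_left hy1 hκpos.le
    rw [← mul_assoc, hκq] at this
    linarith

noncomputable def flipC {n : ℕ} (i : Fin n) : EE n →L[ℝ] EE n :=
  ContinuousLinearMap.id ℝ (EE n) -
    (2:ℝ) • (EuclideanSpace.proj i : EE n →L[ℝ] ℝ).smulRight
      (EuclideanSpace.single i (1:ℝ))

lemma flipC_apply {n : ℕ} (i : Fin n) (x : EE n) :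
    flipC i x = x - (2 * x i) • EuclideanSpace.single i (1:ℝ) := by
  simp [flipC, mul_smul]

lemma flipC_single {n : ℕ} (i j : Fin n) :
    flipC i (EuclideanSpace.single j (1:ℝ)) =
      (if j = i then (-1:ℝ) else 1) • EuclideanSpace.single j (1:ℝ) := by
  rw [flipC_apply]
  by_cases h : j = i
  · subst h
    simp only [PiLp.single_apply, if_true]
    module
  · simp [h, Ne.symm h]

lemma laplacian_flip {n : ℕ} {u : EE n → ℝ} (hu : ContDiff ℝ 2 u) (i : Fin n) (x : EE n) :
    laplacian (fun y => u (flipC i y)) x = laplacian u (flipC i x) := by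
  have hcomp : ∀ {w : EE n → ℝ} (_ : Differentiable ℝ w) (y : EE n) (v : EE n),
      fderiv ℝ (fun y => w (flipC i y)) y v = fderiv ℝ w (flipC i y) (flipC i v) := by
    intro w hw y v
    have : HasFDerivAt (fun y => w (flipC i y)) ((fderiv ℝ w (flipC i y)).comp (flipC i)) y :=
      (hw _).hasFDerivAt.comp y (flipC i).hasFDerivAt
    rw [this.fderiv]; rfl
  unfold laplacian
  apply Finset.sum_congr rfl
  intro j _
  have hu1 := hu.differentiable (by norm_num : (2 : WithTop ℕ∞) ≠ 0)
  have e1 : (fun y => fderiv ℝ (fun y => u (flipC i y)) y (EuclideanSpace.single j 1)) =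
      fun y => (if j = i then (-1:ℝ) else 1) *
        (fun z => fderiv ℝ u z (EuclideanSpace.single j 1)) (flipC i y) := by
    funext y
    rw [hcomp hu1, flipC_single, map_smul, smul_eq_mul]
  have hd := (fderiv_dir_contDiff hu (EuclideanSpace.single j 1)).differentiable
    (by norm_num : (1 : WithTop ℕ∞) ≠ 0)
  have hd2 : DifferentiableAt ℝ (fun y => (fun z => fderiv ℝ u z (EuclideanSpace.single j 1))
      (flipC i y)) x := hd.comp (flipC i).differentiable _
  rw [e1, fderiv_const_mul hd2, smul_apply]
  have := hcomp hd x (EuclideanSpace.single j 1)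
  rw [this, flipC_single, map_smul, smul_eq_mul, smul_eq_mul]
  split_ifs <;> ring

lemma ac_diff_zero {n : ℕ} {u : EE n → ℝ} (hu : IsACSolution u) (i : Fin n) {s : ℝ}
    (hs0 : 0 ≤ s) (hs1 : s ≤ 1) :
    u (s • EuclideanSpace.single i 1) - u (-(s • EuclideanSpace.single i 1)) ≤ 6 * s := by
  have main : u (s • EuclideanSpace.single i 1) - u (-(s • EuclideanSpace.single i 1))
      - 3 * (2 * s - s ^ 2) ≤ 0 := by
    by_contra hcon
    push Not at hcon
    have hflipc : Continuous fun y : EE n => u (flipC i y) :=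
      hu.1.continuous.comp (flipC i).continuous
    have hcoord : Continuous fun y : EE n => y i := by fun_prop
    have hphi : ContDiff ℝ 2 fun y : EE n => u y - u (flipC i y) :=
      hu.1.sub (hu.1.comp (flipC i).contDiff)
    obtain ⟨ε, hεd⟩ : ∃ ε : ℝ, ε = 1 / (n + 1) := ⟨_, rfl⟩
    have hε : 0 < ε := by rw [hεd]; positivity
    have hS : IsClosed {y : EE n | 0 ≤ y i ∧ y i ≤ 1} :=
      (isClosed_le continuous_const hcoord).inter (isClosed_le hcoord continuous_const)
    have hW : Continuous fun y : EE n => u y - u (flipC i y) - 3 * (2 * y i - y i ^ 2) := by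
      have := hu.1.continuous
      fun_prop
    have hx0i : (s • EuclideanSpace.single i (1:ℝ) : EE n) i = s := by simp
    have hflip0 : flipC i (s • EuclideanSpace.single i (1:ℝ)) = -(s • EuclideanSpace.single i (1:ℝ)) := by
      rw [map_smul, flipC_single]; simp
    obtain ⟨x0, hx0⟩ : ∃ x0 : EE n, x0 = s • EuclideanSpace.single i (1:ℝ) := ⟨_, rfl⟩
    have hb : ∀ y : EE n, u y - u (flipC i y) ≤ 2 := fun y => by
      have := ac_le_one hu y
      have := ac_ge_neg_one hu (flipC i y)
      linarith
    obtain ⟨x, hxS, hx⟩ := exists_penal_max hW hS (x0 := x0)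
      (by rw [hx0]; simp only [Set.mem_ofPred_eq, hx0i]; exact ⟨hs0, hs1⟩) (M := 2)
      (fun y hy => by nlinarith [hb y, hy.1, hy.2]) hε
    have hx0val : 0 < u x - u (flipC i x) - 3 * (2 * x i - x i ^ 2) := by
      have h := hx x0 (by rw [hx0]; simp only [Set.mem_ofPred_eq, hx0i]; exact ⟨hs0, hs1⟩)
      have h2 : 0 ≤ ε * ‖x - x0‖ ^ 2 := by positivity
      simp only [sub_self, norm_zero] at h
      have h3 : x0 i = s := by rw [hx0, hx0i]
      have h4 : u x0 - u (flipC i x0) - 3 * (2 * x0 i - x0 i ^ 2) > 0 := by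
        rw [h3, hx0, hflip0]; exact hcon
      nlinarith
    have hxi0 : 0 < x i := by
      rcases hxS.1.eq_or_lt with h | h
      · rw [flipC_apply, ← h] at hx0val
        simp at hx0val
      · exact h
    have hxi1 : x i < 1 := by
      rcases hxS.2.eq_or_lt with h | h
      · rw [h] at hx0val
        linarith [hb x]
      · exact h
    have hnb : ∀ᶠ y in 𝓝 x, y ∈ {y : EE n | 0 ≤ y i ∧ y i ≤ 1} := by
      have h1 : ∀ᶠ y in 𝓝 x, 0 < y i := hcoord.continuousAt.eventually (lt_mem_nhds hxi0)
      have h2 : ∀ᶠ y in 𝓝 x, y i < 1 := hcoord.continuousAt.eventually (gt_mem_nhds hxi1)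
      filter_upwards [h1, h2] with y h1 h2
      exact ⟨h1.le, h2.le⟩
    obtain ⟨d, hd⟩ : ∃ d : EE n, d = x - x0 := ⟨_, rfl⟩
    have key := lap_le hphi x
      (fun j t => ε * (‖d‖ ^ 2 + (2 * d j * t + t ^ 2)) +
        3 * (2 * (x i + (if j = i then 1 else 0) * t) - (x i + (if j = i then 1 else 0) * t) ^ 2))
      (fun j t => ε * (2 * d j + 2 * t) +
        3 * (2 * (if j = i then 1 else 0) - 2 * (x i + (if j = i then 1 else 0) * t) * (if j = i then 1 else 0)))
      (fun j => 2 * ε + (if j = i then -6 else 0)) ?_ ?_ ?_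
    · have hflip2 : ContDiff ℝ 2 fun y : EE n => u (flipC i y) := hu.1.comp (flipC i).contDiff
      rw [Finset.sum_add_distrib, laplacian_sub' hu.1 hflip2,
        laplacian_flip hu.1, ac_lap hu, ac_lap hu] at key
      simp at key
      have h1 : -1 ≤ u x ^ 3 - u x := by
        have := ac_le_one hu x
        have := ac_ge_neg_one hu x
        nlinarith [sq_nonneg (u x), sq_nonneg (u x - 1), sq_nonneg (u x + 1)]
      have h2 : u (flipC i x) ^ 3 - u (flipC i x) ≤ 1 := by
        have := ac_le_one hu (flipC i x)
        have := ac_ge_neg_one hu (flipC i x)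
        nlinarith [sq_nonneg (u (flipC i x)), sq_nonneg (u (flipC i x) - 1), sq_nonneg (u (flipC i x) + 1)]
      have h3 : ε * (n + 1) = 1 := by rw [hεd]; field_simp
      nlinarith
    · intro j
      refine Eventually.of_forall fun t => ?_
      generalize (if j = i then (1:ℝ) else 0) = b
      have q1 : HasDerivAt (fun t : ℝ => ‖d‖ ^ 2 + (2 * d j * t + t ^ 2)) (2 * d j + 2 * t) t := by
        have := (((hasDerivAt_id t).const_mul (2 * d j)).add ((hasDerivAt_id t).pow 2)).const_add (‖d‖^2)
        refine HasDerivAt.congr_deriv this ?_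
        simp
      have q2 : HasDerivAt (fun t : ℝ => x i + b * t) b t := by
        simpa using ((hasDerivAt_id t).const_mul b).const_add (x i)
      have := (q1.const_mul ε).add (((q2.const_mul 2).sub (q2.pow 2)).const_mul 3)
      refine HasDerivAt.congr_deriv this ?_
      simp
    · intro j
      have hb2 : (if j = i then (-6:ℝ) else 0) = -6 * (if j = i then (1:ℝ) else 0) * (if j = i then (1:ℝ) else 0) := by
        split_ifs <;> simp
      rw [hb2]
      generalize (if j = i then (1:ℝ) else 0) = b
      have q1 : HasDerivAt (fun t : ℝ => 2 * d j + 2 * t) 2 0 := by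
        simpa using ((hasDerivAt_id (0:ℝ)).const_mul 2).const_add (2 * d j)
      have q2 : HasDerivAt (fun t : ℝ => x i + b * t) b 0 := by
        simpa using ((hasDerivAt_id (0:ℝ)).const_mul b).const_add (x i)
      have := (q1.const_mul ε).add ((((q2.const_mul 2).mul_const b).const_sub (2 * b)).const_mul 3)
      refine HasDerivAt.congr_deriv this ?_
      ring
    · intro j
      filter_upwards [(tendsto_line x (EuclideanSpace.single j 1)).eventually hnb] with t ht
      have h := hx _ ht
      have e1 : x + t • EuclideanSpace.single j (1:ℝ) - x0 = d + t • EuclideanSpace.single j (1:ℝ) := by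
        rw [hd]; abel
      have e2 : (x + t • EuclideanSpace.single j (1:ℝ)) i = x i + (if j = i then 1 else 0) * t := by
        simp [eq_comm]
      rw [e1, normsq_line, e2, ← hd] at h
      simp only [mul_zero, add_zero, zero_pow (two_ne_zero)]
      linarith
  nlinarith [sq_nonneg s]

lemma ac_dir {n : ℕ} {u : EE n → ℝ} (hu : IsACSolution u) (i : Fin n) (x : EE n) {h : ℝ}
    (hh : |h| ≤ 2) : u (x + h • EuclideanSpace.single i 1) - u x ≤ 3 * |h| := by
  have hc := ac_shift hu (x + (h / 2) • EuclideanSpace.single i 1)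
  rcases le_total 0 h with h0 | h0
  · rw [abs_of_nonneg h0] at hh ⊢
    have := ac_diff_zero hc i (s := h / 2) (by linarith) (by linarith)
    have e1 : (h / 2) • EuclideanSpace.single i (1:ℝ) + (x + (h / 2) • EuclideanSpace.single i 1)
      = x + h • EuclideanSpace.single i 1 := by module
    have e2 : -((h / 2) • EuclideanSpace.single i (1:ℝ)) + (x + (h / 2) • EuclideanSpace.single i 1)
      = x := by module
    rw [e1, e2] at this
    linarith
  · rw [abs_of_nonpos h0] at hh ⊢
    have := ac_diff_zero (ac_neg hc) i (s := - h / 2) (by linarith) (by linarith)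
    have e1 : (-h / 2) • EuclideanSpace.single i (1:ℝ) + (x + (h / 2) • EuclideanSpace.single i 1)
      = x := by module
    have e2 : -((-h / 2) • EuclideanSpace.single i (1:ℝ)) + (x + (h / 2) • EuclideanSpace.single i 1)
      = x + h • EuclideanSpace.single i 1 := by module
    rw [e1, e2] at this
    linarith

lemma ac_partial {n : ℕ} {u : EE n → ℝ} (hu : IsACSolution u) (i : Fin n) (x : EE n) :
    |fderiv ℝ u x (EuclideanSpace.single i 1)| ≤ 3 := by
  have h1 := line_deriv1 hu.1 x (EuclideanSpace.single i 1) 0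
  have h2 := h1.le_of_lip' (C := 3) (by norm_num) ?_
  · simpa using h2
  · have : ∀ᶠ t in 𝓝 (0:ℝ), |t| < 2 := by
      have := (continuous_abs (G := ℝ)).tendsto 0
      exact this.eventually (gt_mem_nhds (by simp))
    filter_upwards [this] with t ht
    have a := ac_dir hu i x ht.le
    have b := ac_dir (ac_neg hu) i x ht.le
    simp only [Real.norm_eq_abs, sub_zero, zero_smul, add_zero]
    rw [abs_le]
    constructor <;> linarith

lemma ac_lip {n : ℕ} {u : EE n → ℝ} (hu : IsACSolution u) (x y : EE n) :
    |u x - u y| ≤ (3 * n + 1) * ‖x - y‖ := by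
  have hbound : ∀ z ∈ (Set.univ : Set (EE n)), ‖fderiv ℝ u z‖ ≤ 3 * n + 1 := by
    intro z _
    apply ContinuousLinearMap.opNorm_le_bound _ (by positivity)
    intro v
    have hv : v = ∑ i, v i • EuclideanSpace.single i (1:ℝ) := by
      ext j
      simp [Finset.sum_apply, Pi.single_apply]
    have h1 : fderiv ℝ u z v = ∑ i, v i * fderiv ℝ u z (EuclideanSpace.single i 1) := by
      conv_lhs => rw [hv]
      simp [map_sum]
    rw [h1]
    calc ‖∑ i, v i * fderiv ℝ u z (EuclideanSpace.single i 1)‖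
        ≤ ∑ i : Fin n, ‖v‖ * 3 := by
          refine norm_sum_le_of_le _ fun i _ => ?_
          rw [norm_mul]
          exact mul_le_mul (PiLp.norm_apply_le v i) (ac_partial hu i z) (norm_nonneg _) (norm_nonneg _)
      _ ≤ (3 * n + 1) * ‖v‖ := by
          simp
          nlinarith [norm_nonneg v]
  have := convex_univ.norm_image_sub_le_of_norm_fderiv_le (𝕜 := ℝ) (f := u)
    (fun z _ => hu.1.differentiable (by norm_num) z) hbound (Set.mem_univ y) (Set.mem_univ x)
  simpa using this

lemma harnack (n : ℕ) {δ R : ℝ} (hδ : 0 < δ) (hR : 0 < R) :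
    ∃ η > 0, ∀ U V : EE n → ℝ, IsACSolution U → IsACSolution V → (∀ x, V x ≤ U x) →
      ∀ x y, ‖x - y‖ ≤ R → δ ≤ U y - V y → η ≤ U x - V x := by
  obtain ⟨L, hL⟩ : ∃ L : ℝ, L = 3 * n + 1 := ⟨_, rfl⟩
  have hLpos : 0 < L := by rw [hL]; positivity
  obtain ⟨r, hr⟩ : ∃ r : ℝ, r = min 1 (δ / (4 * L)) := ⟨_, rfl⟩
  have hrpos : 0 < r := by rw [hr]; positivity
  have hr1 : r ≤ 1 := by rw [hr]; exact min_le_left _ _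
  have hrL : 2 * L * r ≤ δ / 2 := by
    have : r ≤ δ / (4 * L) := by rw [hr]; exact min_le_right _ _
    rw [le_div_iff₀ (by positivity)] at this
    linarith
  obtain ⟨α, hα⟩ : ∃ α : ℝ, α = (n + 1) / r ^ 2 := ⟨_, rfl⟩
  have hαpos : 0 < α := by rw [hα]; positivity
  have hαr : α * r ^ 2 = n + 1 := by rw [hα]; field_simp
  have hα1 : 1 ≤ α := by
    have : r ^ 2 ≤ 1 := by nlinarith
    have hn : (0:ℝ) ≤ n := Nat.cast_nonneg n
    nlinarith
  obtain ⟨κ, hκ⟩ : ∃ κ : ℝ, κ = δ / 2 := ⟨_, rfl⟩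
  have hκpos : 0 < κ := by linarith
  refine ⟨κ * (Real.exp (-α * R ^ 2) - Real.exp (-α * (R + 1) ^ 2)), ?_, ?_⟩
  · have : Real.exp (-α * (R + 1) ^ 2) < Real.exp (-α * R ^ 2) := by
      apply Real.exp_lt_exp.mpr
      nlinarith
    apply mul_pos hκpos
    linarith
  intro U V hU hV hle x0 y hxy hz
  have hzC : ContDiff ℝ 2 fun x => U x - V x := hU.1.sub hV.1
  have hcont : Continuous fun x => (U x - V x) -
      κ * (Real.exp (-α * ‖x - y‖ ^ 2) - Real.exp (-α * (R + 1) ^ 2)) := by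
    have := hzC.continuous
    fun_prop
  have hρ : 0 < R + 1 := by linarith
  obtain ⟨x, hx, hmin⟩ := (isCompact_closedBall y (R + 1)).exists_isMinOn
    ⟨y, Metric.mem_closedBall_self hρ.le⟩ hcont.continuousOn
  have hxR : ‖x - y‖ ≤ R + 1 := by simpa [dist_eq_norm] using hx
  have claim : 0 ≤ (U x - V x) -
      κ * (Real.exp (-α * ‖x - y‖ ^ 2) - Real.exp (-α * (R + 1) ^ 2)) := by
    by_contra hneg
    push Not at hneg
    have hzx : 0 ≤ U x - V x := by linarith [hle x]
    have hxlt : ‖x - y‖ < R + 1 := by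
      rcases hxR.eq_or_lt with h | h
      · rw [h] at hneg; simp at hneg; linarith
      · exact h
    have hE : 0 < Real.exp (-α * (R + 1) ^ 2) := Real.exp_pos _
    have hxr : r < ‖x - y‖ := by
      by_contra hc
      push Not at hc
      have h1 := ac_lip hU x y
      have h2 := ac_lip hV x y
      rw [← hL] at h1 h2
      have h3 : L * ‖x - y‖ ≤ L * r := by gcongr
      have h4 : Real.exp (-α * ‖x - y‖ ^ 2) ≤ 1 := by
        rw [Real.exp_le_one_iff]
        have : 0 ≤ α * ‖x - y‖ ^ 2 := by positivity
        linarith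
      rw [abs_le] at h1 h2
      have h5 : κ * (Real.exp (-α * ‖x - y‖ ^ 2) - Real.exp (-α * (R + 1) ^ 2)) ≤ κ * 1 := by
        gcongr; linarith
      linarith [h1.1, h2.2]
    have key := lap_ge_radial hzC x y
      (fun s => κ * (Real.exp (-α * s) - Real.exp (-α * (R + 1) ^ 2)))
      (fun s => κ * (Real.exp (-α * s) * (-α))) (κ * (Real.exp (-α * ‖x - y‖ ^ 2) * (-α) * (-α))) ?_ ?_ ?_
    · rw [laplacian_sub' hU.1 hV.1, ac_lap hU, ac_lap hV] at key
      have hs : r ^ 2 ≤ ‖x - y‖ ^ 2 := by gcongr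
      generalize ‖x - y‖ ^ 2 = s at *
      have hexp : 0 < Real.exp (-α * s) := Real.exp_pos _
      generalize Real.exp (-α * s) = E at *
      have h1 : U x ^ 3 - U x - (V x ^ 3 - V x) ≤ 2 * (U x - V x) := by
        have a1 := ac_le_one hU x
        have a2 := ac_ge_neg_one hU x
        have a3 := ac_le_one hV x
        have a4 := ac_ge_neg_one hV x
        have h0 : U x ^ 2 + U x * V x + V x ^ 2 - 1 ≤ 2 := by nlinarith
        nlinarith
      have h2 : 2 ≤ 4 * s * (α * α) - 2 * n * α := by
        have b1 : (n + 1) * α ≤ s * (α * α) := by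
          calc (n + 1) * α = r ^ 2 * (α * α) := by rw [← hαr]; ring
            _ ≤ s * (α * α) := by gcongr
        have hn : (0:ℝ) ≤ n := Nat.cast_nonneg n
        nlinarith
      have h3 : 2 * (κ * E) ≤ (4 * s * (α * α) - 2 * n * α) * (κ * E) := by
        gcongr
      have h4 : κ * (E - Real.exp (-α * (R + 1) ^ 2)) < κ * E := by
        apply mul_lt_mul_of_pos_left _ hκpos; linarith
      nlinarith
    · refine Eventually.of_forall fun s => ?_
      have := ((((hasDerivAt_id s).const_mul (-α)).exp).sub_const (Real.exp (-α * (R + 1) ^ 2))).const_mul κ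
      refine HasDerivAt.congr_deriv this ?_
      simp
    · have := ((((hasDerivAt_id (‖x - y‖ ^ 2)).const_mul (-α)).exp).mul_const (-α)).const_mul κ
      refine HasDerivAt.congr_deriv this ?_
      simp
    · have hopen : ∀ᶠ w in 𝓝 x, w ∈ Metric.ball y (R + 1) :=
        Metric.isOpen_ball.eventually_mem (by simpa [dist_eq_norm] using hxlt)
      filter_upwards [hopen] with w hw
      exact hmin (Metric.ball_subset_closedBall hw)
  have hx0 := hmin (show x0 ∈ Metric.closedBall y (R + 1) by
    simp only [Metric.mem_closedBall, dist_eq_norm]; linarith)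
  simp only [Set.mem_ofPred_eq] at hx0
  have h1 : Real.exp (-α * R ^ 2) ≤ Real.exp (-α * ‖x0 - y‖ ^ 2) := by
    apply Real.exp_le_exp.mpr
    have : ‖x0 - y‖ ^ 2 ≤ R ^ 2 := by gcongr
    nlinarith
  have h2 : κ * (Real.exp (-α * R ^ 2) - Real.exp (-α * (R + 1) ^ 2)) ≤
    κ * (Real.exp (-α * ‖x0 - y‖ ^ 2) - Real.exp (-α * (R + 1) ^ 2)) := by gcongr
  linarith

lemma mp_cover {n : ℕ} {U V : EE n → ℝ} (hU : IsACSolution U) (hV : IsACSolution V)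
    (h : ∀ x, U x < V x → 4 / 5 ≤ U x ∨ V x ≤ -(4 / 5)) (x : EE n) : V x ≤ U x := by
  have := mp_global (W := fun x => V x - U x) (hV.1.sub hU.1) (M := 2) (c := 1 / 2)
    (fun y => by linarith [ac_le_one hV y, ac_ge_neg_one hU y]) (by norm_num) ?_ x
  · linarith
  · intro y hy
    rw [laplacian_sub' hV.1 hU.1, ac_lap hU, ac_lap hV]
    have h1 : 3 / 2 ≤ V y ^ 2 + V y * U y + U y ^ 2 := by
      rcases h y (by linarith) with h | h <;> nlinarith
    nlinarith

lemma sliding {n : ℕ} {U V : EE n → ℝ} (hU : IsACSolution U) (hV : IsACSolution V)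
    (e ν : EE n) (hν : 0 < ⟪ν, e⟫) (B : ℝ)
    (hUB : ∀ x : EE n, B ≤ ⟪x, e⟫ → 4 / 5 ≤ U x)
    (hVB : ∀ x : EE n, ⟪x, e⟫ ≤ -B → V x ≤ -(4 / 5)) (τ₁ : ℝ) :
    (∀ τ, τ₁ ≤ τ → ∀ x, V (x - τ • ν) ≤ U x) ∨
    ∃ τ, τ₁ < τ ∧ (∀ x, V (x - τ • ν) ≤ U x) ∧ ∃ C : ℝ, 0 ≤ C ∧ ∀ ε > 0, ∀ R > 0, ∃ y : EE n,
      |⟪y, e⟫| ≤ C ∧ ∀ x, ‖x - y‖ ≤ R → U x - V (x - τ • ν) ≤ ε := by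
  have hVs : ∀ τ : ℝ, IsACSolution fun x => V (x - τ • ν) := fun τ => by
    simpa [sub_eq_add_neg] using ac_shift hV (-(τ • ν))
  obtain ⟨T, hT⟩ : ∃ T : Set ℝ, T = {τ | ∀ τ', τ ≤ τ' → ∀ x, V (x - τ' • ν) ≤ U x} := ⟨_, rfl⟩
  have memT : ∀ τ, τ ∈ T ↔ ∀ τ', τ ≤ τ' → ∀ x, V (x - τ' • ν) ≤ U x := by
    intro τ; rw [hT]; rfl
  by_cases h1 : τ₁ ∈ T
  · left; exact (memT _).1 h1
  right
  have hin : ∀ (τ : ℝ) (x : EE n), ⟪x - τ • ν, e⟫ = ⟪x, e⟫ - τ * ⟪ν, e⟫ := by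
    intro τ x; rw [inner_sub_left, real_inner_smul_left]
  have hne : T.Nonempty := by
    refine ⟨2 * |B| / ⟪ν, e⟫, (memT _).2 fun τ hτ => ?_⟩
    apply mp_cover hU (hVs τ)
    intro x _
    by_cases hx : B ≤ ⟪x, e⟫
    · left; exact hUB x hx
    · right
      apply hVB
      rw [hin]
      rw [div_le_iff₀ hν] at hτ
      linarith [le_abs_self B, neg_abs_le B]
  have hlb : ∀ τ ∈ T, τ₁ ≤ τ := by
    intro τ hτ
    by_contra hc
    push Not at hc
    exact h1 ((memT _).2 fun τ' hτ' => (memT _).1 hτ τ' (by linarith))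
  have hbdd : BddBelow T := ⟨τ₁, hlb⟩
  obtain ⟨t, ht⟩ : ∃ t, t = sInf T := ⟨_, rfl⟩
  have hgt : ∀ τ, t < τ → ∀ x, V (x - τ • ν) ≤ U x := by
    intro τ hτ
    obtain ⟨τ', h2, h3⟩ := exists_lt_of_csInf_lt hne (ht ▸ hτ)
    exact (memT _).1 h2 τ h3.le
  have hteq : ∀ x, V (x - t • ν) ≤ U x := by
    intro x
    have hc : Continuous fun τ : ℝ => V (x - τ • ν) := by
      have := hV.1.continuous
      fun_prop
    have h2 : Tendsto (fun τ : ℝ => V (x - τ • ν)) (𝓝[>] t) (𝓝 (V (x - t • ν))) :=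
      (hc.tendsto t).mono_left nhdsWithin_le_nhds
    exact le_of_tendsto h2 (eventually_nhdsWithin_of_forall fun τ hτ => hgt τ hτ x)
  have htT : t ∈ T := (memT _).2 fun τ hτ => by
    rcases hτ.eq_or_lt with h | h
    · rw [← h]; exact hteq
    · exact hgt τ h
  have htlt : τ₁ < t := lt_of_le_of_ne (hlb t htT) (fun h => h1 (h ▸ htT))
  have hC0 : 0 ≤ |B| + (|t| + 1) * ⟪ν, e⟫ := by positivity
  refine ⟨t, htlt, hteq, |B| + (|t| + 1) * ⟪ν, e⟫, hC0, ?_⟩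
  by_contra hcon
  push Not at hcon
  obtain ⟨ε, hε, R, hR, hcon⟩ := hcon
  obtain ⟨η, hη, hH⟩ := harnack n hε hR
  have hslab : ∀ y : EE n, |⟪y, e⟫| ≤ |B| + (|t| + 1) * ⟪ν, e⟫ → η ≤ U y - V (y - t • ν) := by
    intro y hy
    obtain ⟨x, hx, hx2⟩ := hcon y hy
    exact hH U _ hU (hVs t) hteq y x (by rw [norm_sub_rev]; exact hx) hx2.le
  obtain ⟨L, hL⟩ : ∃ L : ℝ, L = 3 * n + 1 := ⟨_, rfl⟩
  have hLpos : 0 < L := by rw [hL]; positivity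
  obtain ⟨σ, hσ⟩ : ∃ σ : ℝ, σ = min 1 (η / (L * (‖ν‖ + 1))) := ⟨_, rfl⟩
  have hσpos : 0 < σ := by rw [hσ]; positivity
  have hσ1 : σ ≤ 1 := by rw [hσ]; exact min_le_left _ _
  have hσL : L * (σ * ‖ν‖) ≤ η := by
    have : σ ≤ η / (L * (‖ν‖ + 1)) := by rw [hσ]; exact min_le_right _ _
    rw [le_div_iff₀ (by positivity)] at this
    nlinarith [mul_pos hσpos hLpos]
  have : t - σ ∈ T := (memT _).2 fun τ hτ => by
    by_cases hτt : t ≤ τ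
    · exact (memT _).1 htT τ hτt
    push Not at hτt
    apply mp_cover hU (hVs τ)
    intro x hx
    by_cases hxs : |⟪x, e⟫| ≤ |B| + (|t| + 1) * ⟪ν, e⟫
    · exfalso
      have a1 := hslab x hxs
      have a2 := ac_lip hV (x - τ • ν) (x - t • ν)
      have a3 : x - τ • ν - (x - t • ν) = (t - τ) • ν := by module
      rw [a3, norm_smul, ← hL, Real.norm_eq_abs, abs_of_pos (by linarith : 0 < t - τ)] at a2
      have a4 : L * ((t - τ) * ‖ν‖) ≤ L * (σ * ‖ν‖) := by gcongr; linarith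
      have a5 := le_of_abs_le a2
      linarith
    · push Not at hxs
      rcases lt_abs.1 hxs with h | h
      · left
        apply hUB
        have : 0 ≤ (|t| + 1) * ⟪ν, e⟫ := by positivity
        linarith [le_abs_self B]
      · right
        apply hVB
        rw [hin]
        have : -(|t| + 1) * ⟪ν, e⟫ ≤ τ * ⟪ν, e⟫ := by
          gcongr
          linarith [neg_abs_le t]
        linarith [le_abs_self B]
  have := csInf_le hbdd this
  linarith

lemma H_hasDerivAt (t : ℝ) : HasDerivAt H ((1 - H t ^ 2) / Real.sqrt 2) t := by
  have hc := (Real.cosh_pos (t / Real.sqrt 2)).ne'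
  have h0 : HasDerivAt (fun t : ℝ => t / Real.sqrt 2) (1 / Real.sqrt 2) t :=
    (hasDerivAt_id t).div_const _
  have h1 := (h0.sinh).div h0.cosh hc
  have e : H = fun t : ℝ => Real.sinh (t / Real.sqrt 2) / Real.cosh (t / Real.sqrt 2) := by
    funext t; unfold H; rw [Real.tanh_eq_sinh_div_cosh]
  rw [e]
  refine HasDerivAt.congr_deriv h1 ?_
  field_simp

lemma H_contDiff : ContDiff ℝ 2 H := by
  have e : H = fun t : ℝ => Real.sinh (t / Real.sqrt 2) / Real.cosh (t / Real.sqrt 2) := by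
    funext t; unfold H; rw [Real.tanh_eq_sinh_div_cosh]
  rw [e]
  apply ContDiff.div
  · exact Real.contDiff_sinh.comp (contDiff_id.div_const _)
  · exact Real.contDiff_cosh.comp (contDiff_id.div_const _)
  · intro t; exact (Real.cosh_pos _).ne'

lemma H_neg (t : ℝ) : H (-t) = - H t := by
  unfold H; rw [neg_div, Real.tanh_neg]

lemma H_ge {t : ℝ} (ht : 0 ≤ t) : 1 - 1 / (1 + t / Real.sqrt 2) ≤ H t := by
  unfold H
  obtain ⟨x, hx⟩ : ∃ x, x = t / Real.sqrt 2 := ⟨_, rfl⟩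
  have hx0 : 0 ≤ x := by rw [hx]; positivity
  rw [← hx, Real.tanh_eq, Real.exp_neg]
  have h1 : 1 + x ≤ Real.exp x := by linarith [Real.add_one_le_exp x]
  generalize Real.exp x = E at *
  have hE : 0 < E := by linarith
  have h2 : (E - E⁻¹) / (E + E⁻¹) = 1 - 2 / (E ^ 2 + 1) := by field_simp; ring
  rw [h2]
  have h3 : 2 / (E ^ 2 + 1) ≤ 1 / (1 + x) := by
    rw [div_le_div_iff₀ (by positivity) (by positivity)]
    nlinarith
  linarith

lemma H_large {t : ℝ} (ht : 8 ≤ t) : 4 / 5 ≤ H t := by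
  have h := H_ge (t := t) (by linarith)
  have hs : 0 < Real.sqrt 2 := by positivity
  have hs2 : Real.sqrt 2 ≤ 2 := by
    rw [Real.sqrt_le_left (by norm_num)]; norm_num
  have h1 : 4 ≤ t / Real.sqrt 2 := by
    rw [le_div_iff₀ hs]; linarith
  have h2 : 1 / (1 + t / Real.sqrt 2) ≤ 1 / 5 := by
    rw [div_le_div_iff₀ (by positivity) (by norm_num)]; linarith
  linarith

lemma H_exists_gt {c : ℝ} (hc : c < 1) : ∃ t, c < H t := by
  have hs : 0 < Real.sqrt 2 := by positivity
  have hd : 0 < 1 - c := by linarith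
  refine ⟨Real.sqrt 2 * (1 / (1 - c)), ?_⟩
  have h := H_ge (t := Real.sqrt 2 * (1 / (1 - c))) (by positivity)
  have e : Real.sqrt 2 * (1 / (1 - c)) / Real.sqrt 2 = 1 / (1 - c) := by field_simp
  rw [e] at h
  have h2 : 1 / (1 + 1 / (1 - c)) < 1 - c := by
    rw [div_lt_iff₀ (by positivity)]
    have : (1 - c) * (1 + 1 / (1 - c)) = (1 - c) + 1 := by field_simp
    linarith
  linarith

lemma H_ac {n : ℕ} {e : EE n} (he : ‖e‖ = 1) : IsACSolution fun x : EE n => H ⟪x, e⟫ := by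
  have hlin : ∀ y : EE n, HasFDerivAt (fun x : EE n => ⟪x, e⟫) (innerSL ℝ e) y := by
    intro y
    have := (innerSL ℝ e).hasFDerivAt (x := y)
    refine this.congr_of_eventuallyEq (Eventually.of_forall fun z => ?_)
    simp [real_inner_comm]
  refine ⟨H_contDiff.comp (contDiff_id.inner ℝ contDiff_const), fun x => ?_⟩
  have hs : Real.sqrt 2 * Real.sqrt 2 = 2 := Real.mul_self_sqrt (by norm_num)
  have hs0 : Real.sqrt 2 ≠ 0 := by positivity
  have e1 : ∀ i : Fin n, (fun y : EE n => fderiv ℝ (fun x : EE n => H ⟪x, e⟫) y (EuclideanSpace.single i 1))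
      = fun y => ((1 - H ⟪y, e⟫ ^ 2) / Real.sqrt 2) * e i := by
    intro i
    funext y
    have := (H_hasDerivAt ⟪y, e⟫).comp_hasFDerivAt y (hlin y)
    have h2 : fderiv ℝ (fun x : EE n => H ⟪x, e⟫) y = _ := this.fderiv
    rw [h2]
    simp [EuclideanSpace.inner_single_right]
  have e2 : ∀ i : Fin n, fderiv ℝ (fun y : EE n => ((1 - H ⟪y, e⟫ ^ 2) / Real.sqrt 2) * e i) x
      (EuclideanSpace.single i 1) = -(H ⟪x, e⟫ - H ⟪x, e⟫ ^ 3) * e i ^ 2 := by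
    intro i
    have h0 : HasDerivAt (fun t => ((1 - H t ^ 2) / Real.sqrt 2) * e i) 
        (-(H ⟪x, e⟫ - H ⟪x, e⟫ ^ 3) * e i) ⟪x, e⟫ := by
      have := ((((H_hasDerivAt ⟪x, e⟫).pow 2).const_sub 1).div_const (Real.sqrt 2)).mul_const (e i)
      refine HasDerivAt.congr_deriv this ?_
      field_simp
      rw [Real.sq_sqrt (by norm_num)]
      push_cast
      ring
    have h3 := h0.comp_hasFDerivAt x (hlin x)
    have h2 : fderiv ℝ (fun y : EE n => ((1 - H ⟪y, e⟫ ^ 2) / Real.sqrt 2) * e i) x = _ :=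
      h3.fderiv
    rw [h2]
    simp [EuclideanSpace.inner_single_right]
    ring
  unfold laplacian
  simp only [e1, e2]
  rw [← Finset.mul_sum, ← EuclideanSpace.real_norm_sq_eq, he]
  ring

lemma slide_H {n : ℕ} {u : EE n → ℝ} (hu : IsACSolution u) {e : EE n} (he : ‖e‖ = 1) (B : ℝ)
    (hB : ∀ x : EE n, B ≤ ⟪x, e⟫ → 4 / 5 ≤ u x) (x₁ : EE n) (hx₁ : u x₁ < 1) :
    ∃ τ : ℝ, (∀ x : EE n, H (⟪x, e⟫ - τ) ≤ u x) ∧ ∃ C : ℝ, 0 ≤ C ∧ ∀ ε > 0, ∀ R > 0, ∃ y : EE n,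
      |⟪y, e⟫| ≤ C ∧ ∀ x, ‖x - y‖ ≤ R → u x - H (⟪x, e⟫ - τ) ≤ ε := by
  have hee : ⟪e, e⟫ = 1 := by rw [real_inner_self_eq_norm_sq, he]; norm_num
  obtain ⟨t, ht⟩ := H_exists_gt hx₁
  have hin : ∀ (τ : ℝ) (x : EE n), ⟪x - τ • e, e⟫ = ⟪x, e⟫ - τ := by
    intro τ x; rw [inner_sub_left, real_inner_smul_left, hee, mul_one]
  rcases sliding hu (H_ac he) e e (by rw [hee]; norm_num) (max B 8)
    (fun x hx => hB x ((le_max_left _ _).trans hx))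
    (fun x hx => by
      have h1 : 8 ≤ -⟪x, e⟫ := by linarith [le_max_right B 8]
      have h2 := H_large h1
      rw [H_neg] at h2
      linarith) (⟪x₁, e⟫ - t) with h | ⟨τ, -, h1, C, hC, h2⟩
  · exfalso
    have := h _ le_rfl x₁
    simp only [hin] at this
    rw [sub_sub_cancel] at this
    linarith
  · simp only [hin] at h1 h2
    exact ⟨τ, h1, C, hC, h2⟩

lemma case_pp {n : ℕ} {u : EE n → ℝ} (hu : IsACSolution u) {e : EE n} (he : ‖e‖ = 1) (B : ℝ)
    (hB : ∀ x : EE n, B ≤ ⟪x, e⟫ → 4 / 5 ≤ u x) (hB' : ∀ x : EE n, ⟪x, e⟫ ≤ -B → 4 / 5 ≤ u x)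
    (x : EE n) : u x = 1 := by
  have hee : ⟪e, e⟫ = 1 := by rw [real_inner_self_eq_norm_sq, he]; norm_num
  refine le_antisymm (ac_le_one hu x) ?_
  by_contra hcon
  push Not at hcon
  obtain ⟨τ, -, C, hC, h⟩ := slide_H hu he B hB x hcon
  obtain ⟨y, hy, hyR⟩ := h (1 / 2) (by norm_num) (C + |B| + |τ| + 8) (by positivity)
  have h1 := hyR (y - (C + |B| + |τ| + 8) • e) (by
    rw [sub_sub_cancel_left, norm_neg, norm_smul, he, mul_one, Real.norm_eq_abs,
      abs_of_nonneg (by positivity)])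
  have h2 : ⟪y - (C + |B| + |τ| + 8) • e, e⟫ = ⟪y, e⟫ - (C + |B| + |τ| + 8) := by
    rw [inner_sub_left, real_inner_smul_left, hee, mul_one]
  have hyC := le_of_abs_le hy
  have h3 := hB' (y - (C + |B| + |τ| + 8) • e) (by
    rw [h2]; linarith [le_abs_self B, abs_nonneg τ])
  have h4 : 8 ≤ -(⟪y - (C + |B| + |τ| + 8) • e, e⟫ - τ) := by
    rw [h2]; linarith [abs_nonneg B, neg_abs_le τ]
  have h5 := H_large h4
  rw [H_neg] at h5
  linarith

lemma mono_dir {n : ℕ} {u : EE n → ℝ} (hu : IsACSolution u) {e : EE n} (B : ℝ)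
    (hB : ∀ x : EE n, B ≤ ⟪x, e⟫ → 4 / 5 ≤ u x)
    (hB' : ∀ x : EE n, ⟪x, e⟫ ≤ -B → u x ≤ -(4 / 5))
    (ν : EE n) (hν : 0 < ⟪ν, e⟫) (x : EE n) : u (x - ν) ≤ u x := by
  rcases sliding hu hu e ν hν B hB hB' 0 with h | ⟨τ, hτ, -, C, hC, h⟩
  · simpa using h 1 (by norm_num) x
  exfalso
  obtain ⟨M, hM⟩ := exists_nat_ge ((C + |B|) / (τ * ⟪ν, e⟫))
  rw [div_le_iff₀ (by positivity)] at hM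
  obtain ⟨y, hy, hyR⟩ := h (1 / (2 * M + 1)) (by positivity) (M * τ * ‖ν‖ + 1) (by positivity)
  have hyC := abs_le.1 hy
  have hind : ∀ k : ℕ, k ≤ 2 * M → u (y + (((k:ℝ) - M) * τ) • ν) ≤
      u (y + ((-(M:ℝ)) * τ) • ν) + k * (1 / (2 * M + 1)) := by
    intro k
    induction k with
    | zero => intro _; simp
    | succ k ih =>
      intro hk
      have hk' : ((k:ℝ) + 1) ≤ 2 * M := by exact_mod_cast hk
      have hk0 : (0:ℝ) ≤ k := Nat.cast_nonneg k
      have h1 := ih (by omega)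
      have h2 := hyR (y + ((((k + 1 : ℕ):ℝ) - M) * τ) • ν) (by
        rw [add_sub_cancel_left, norm_smul, norm_mul, Real.norm_eq_abs, Real.norm_eq_abs, abs_of_pos hτ]
        have : |((k + 1 : ℕ):ℝ) - M| ≤ M := by
          rw [abs_le]; push_cast; constructor <;> linarith
        have : |((k + 1 : ℕ):ℝ) - M| * τ * ‖ν‖ ≤ M * τ * ‖ν‖ := by gcongr
        linarith)
      have e1 : y + ((((k + 1 : ℕ):ℝ) - M) * τ) • ν - τ • ν = y + (((k:ℝ) - M) * τ) • ν := by
        push_cast; module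
      rw [e1] at h2
      push_cast at h2 ⊢
      linarith
  have hfin := hind (2 * M) le_rfl
  have hin : ∀ c : ℝ, ⟪y + c • ν, e⟫ = ⟪y, e⟫ + c * ⟪ν, e⟫ := by
    intro c; rw [inner_add_left, real_inner_smul_left]
  have a1 := hB (y + ((((2 * M : ℕ):ℝ) - M) * τ) • ν) (by
    rw [hin]; push_cast
    have : (2 * (M:ℝ) - M) * τ * ⟪ν, e⟫ = M * (τ * ⟪ν, e⟫) := by ring
    rw [this]
    linarith [le_abs_self B])
  have a2 := hB' (y + ((-(M:ℝ)) * τ) • ν) (by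
    rw [hin]
    have : -(M:ℝ) * τ * ⟪ν, e⟫ = - (M * (τ * ⟪ν, e⟫)) := by ring
    rw [this]
    linarith [le_abs_self B])
  have a3 : ((2 * M : ℕ):ℝ) * (1 / (2 * M + 1)) ≤ 1 := by
    push_cast
    rw [mul_one_div, div_le_one (by positivity)]
    linarith
  linarith

lemma case_pm {n : ℕ} {u : EE n → ℝ} (hu : IsACSolution u) {e : EE n} (he : ‖e‖ = 1) (B : ℝ)
    (hB : ∀ x : EE n, B ≤ ⟪x, e⟫ → 4 / 5 ≤ u x)
    (hB' : ∀ x : EE n, ⟪x, e⟫ ≤ -B → u x ≤ -(4 / 5)) :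
    ∃ a : ℝ, ∀ x : EE n, u x = H (⟪x, e⟫ + a) := by
  have hee : ⟪e, e⟫ = 1 := by rw [real_inner_self_eq_norm_sq, he]; norm_num
  have hle : ∀ ν : EE n, ⟪ν, e⟫ = 0 → ∀ x, u (x - ν) ≤ u x := by
    intro ν hν x
    have hc : Continuous fun δ : ℝ => u (x - (ν + δ • e)) := by
      have := hu.1.continuous
      fun_prop
    have h2 : Tendsto (fun δ : ℝ => u (x - (ν + δ • e))) (𝓝[>] 0) (𝓝 (u (x - (ν + (0:ℝ) • e)))) :=
      (hc.tendsto 0).mono_left nhdsWithin_le_nhds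
    have := le_of_tendsto h2 (eventually_nhdsWithin_of_forall fun δ hδ =>
      mono_dir hu B hB hB' (ν + δ • e) (by
        rw [inner_add_left, real_inner_smul_left, hν, hee]
        simpa using hδ) x)
    simpa using this
  have hinv : ∀ x y : EE n, ⟪x, e⟫ = ⟪y, e⟫ → u x = u y := by
    intro x y hxy
    apply le_antisymm
    · have := hle (y - x) (by rw [inner_sub_left, hxy, sub_self]) y
      simpa using this
    · have := hle (x - y) (by rw [inner_sub_left, hxy, sub_self]) x
      simpa using this
  obtain ⟨τ, h1, C, hC, h⟩ := slide_H hu he B hB ((-B) • e) (by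
    have := hB' ((-B) • e) (by rw [real_inner_smul_left, hee, mul_one])
    linarith)
  refine ⟨-τ, fun x => ?_⟩
  rw [← sub_eq_add_neg]
  refine le_antisymm ?_ (h1 x)
  apply le_of_forall_pos_le_add
  intro ε hε
  obtain ⟨y, hy, hyR⟩ := h ε hε (C + |⟪x, e⟫| + 1) (by positivity)
  have h3 := hyR (y + (⟪x, e⟫ - ⟪y, e⟫) • e) (by
    rw [add_sub_cancel_left, norm_smul, he, mul_one, Real.norm_eq_abs]
    have := abs_sub ⟪x, e⟫ ⟪y, e⟫
    linarith)
  have h4 : ⟪y + (⟪x, e⟫ - ⟪y, e⟫) • e, e⟫ = ⟪x, e⟫ := by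
    rw [inner_add_left, real_inner_smul_left, hee]; ring
  rw [h4, hinv _ x h4] at h3
  linarith

lemma sign_half {n : ℕ} {u : EE n → ℝ} (hu : IsACSolution u) {e : EE n} (he : ‖e‖ = 1) (A : ℝ)
    (hA : ∀ x : EE n, A ≤ ⟪x, e⟫ → u x ≠ 0) :
    (∀ x : EE n, A + (8 + 4 * n) ≤ ⟪x, e⟫ → 4 / 5 ≤ u x) ∨
    (∀ x : EE n, A + (8 + 4 * n) ≤ ⟪x, e⟫ → u x ≤ -(4 / 5)) := by
  have hconv : Convex ℝ {x : EE n | A ≤ ⟪x, e⟫} := by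
    intro x hx y hy a b ha hb hab
    simp only [Set.mem_ofPred_eq] at *
    rw [inner_add_left, real_inner_smul_left, real_inner_smul_left]
    have : A = a * A + b * A := by rw [← add_mul, hab, one_mul]
    rw [this]
    gcongr
  have hpre := hconv.isPreconnected
  have hball : ∀ x : EE n, A + (8 + 4 * n) ≤ ⟪x, e⟫ →
      ∀ z ∈ Metric.closedBall x (8 + 4 * (n:ℝ)), A ≤ ⟪z, e⟫ := by
    intro x hx z hz
    have h1 : ‖z - x‖ ≤ 8 + 4 * n := by simpa [dist_eq_norm] using hz
    have h2 := abs_real_inner_le_norm (z - x) e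
    rw [he, mul_one, inner_sub_left] at h2
    have := (abs_le.1 (h2.trans h1)).1
    linarith
  have hsign : (∀ x : EE n, A ≤ ⟪x, e⟫ → 0 < u x) ∨ (∀ x : EE n, A ≤ ⟪x, e⟫ → u x < 0) := by
    by_contra hcon
    push Not at hcon
    obtain ⟨⟨x, hx, hx0⟩, ⟨y, hy, hy0⟩⟩ := hcon
    obtain ⟨z, hz, hz0⟩ := hpre.intermediate_value hx hy hu.1.continuous.continuousOn ⟨hx0, hy0⟩
    exact hA z hz hz0
  rcases hsign with h | h
  · left
    intro x hx
    exact ac_lower hu x fun z hz => h z (hball x hx z hz)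
  · right
    intro x hx
    have := ac_lower (ac_neg hu) x fun z hz => by
      have := h z (hball x hx z hz)
      linarith
    linarith

theorem slab_rigidity {n : ℕ} (hn1 : 1 ≤ n)
    (u : EuclideanSpace ℝ (Fin n) → ℝ)
    (hu : IsACSolution u) (hnc : ¬ ∃ c : ℝ, ∀ x, u x = c)
    (e : EuclideanSpace ℝ (Fin n)) (he : ‖e‖ = 1) (A : ℝ) (hA : 0 < A)
    (hsub : {x : EuclideanSpace ℝ (Fin n) | u x = 0} ⊆
      {x : EuclideanSpace ℝ (Fin n) | |⟪x, e⟫| < A}) :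
    ∃ a : ℝ,
      (∀ x : EuclideanSpace ℝ (Fin n), u x = H (-⟪x, e⟫ + a)) ∨
      (∀ x : EuclideanSpace ℝ (Fin n), u x = H (⟪x, e⟫ + a)) := by
  have hne : ∀ x : EE n, A ≤ |⟪x, e⟫| → u x ≠ 0 := by
    intro x hx h0
    have h1 : |⟪x, e⟫| < A := hsub h0
    linarith
  have hr := sign_half hu he A (fun x hx => hne x (hx.trans (le_abs_self _)))
  have hl := sign_half hu (e := -e) (by rw [norm_neg, he]) A (fun x hx => hne x (by
    rw [inner_neg_right] at hx
    exact hx.trans (neg_le_abs _)))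
  simp only [inner_neg_right] at hl
  obtain ⟨B, hBd⟩ : ∃ B : ℝ, B = A + (8 + 4 * n) := ⟨_, rfl⟩
  rw [← hBd] at hr hl
  rcases hr with hr | hr <;> rcases hl with hl | hl
  · exfalso
    exact hnc ⟨1, case_pp hu he B hr fun x hx => hl x (by linarith)⟩
  · obtain ⟨a, ha⟩ := case_pm hu he B hr fun x hx => hl x (by linarith)
    exact ⟨a, Or.inr ha⟩
  · obtain ⟨a, ha⟩ := case_pm (ac_neg hu) he B (fun x hx => by linarith [hr x hx])
      fun x hx => by linarith [hl x (by linarith)]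
    refine ⟨-a, Or.inl fun x => ?_⟩
    have h1 := ha x
    have h2 : -⟪x, e⟫ + -a = -(⟪x, e⟫ + a) := by ring
    rw [h2, H_neg]
    linarith
  · exfalso
    refine hnc ⟨-1, fun x => ?_⟩
    have := case_pp (ac_neg hu) he B (fun x hx => by linarith [hr x hx])
      (fun x hx => by linarith [hl x (by linarith)]) x
    linarith
end

section
/- Let n ≥ 1 and let u be a solution of the Allen–Cahn equation −Δu = u − u³ on ℝⁿ satisfying Modica's inequality |∇u(x)|² ≤ (1 − u(x)²)²/2 for all x, together with −1 < u(x) ≤ H(xₙ + a) for all x ∈ ℝⁿ, where a is a fixed real number. Then |∇u(x)| ≤ 2√2 · e^{√2 (xₙ + a)} for all x ∈ ℝⁿ. -/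
open scoped RealInnerProductSpace

lemma one_add_H_le (s : ℝ) : 1 + H s ≤ 2 * Real.exp (Real.sqrt 2 * s) := by
  have hs : Real.sqrt 2 * s = s / Real.sqrt 2 + s / Real.sqrt 2 := by
    have h2 : Real.sqrt 2 ^ 2 = 2 := Real.sq_sqrt (by norm_num)
    field_simp
    linear_combination s * h2
  rw [hs, Real.exp_add, H, Real.tanh_eq_sinh_div_cosh, Real.sinh_eq, Real.cosh_eq]
  generalize s / Real.sqrt 2 = t
  have hp := Real.exp_pos t
  have hq := Real.exp_pos (-t)
  have hpq : Real.exp t * Real.exp (-t) = 1 := by rw [← Real.exp_add]; simp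
  generalize Real.exp t = p at *
  generalize Real.exp (-t) = q at *
  have : 1 + (p - q) / 2 / ((p + q) / 2) = 2 * p / (p + q) := by field_simp; ring
  rw [this, div_le_iff₀ (by positivity)]
  have : 2 * (p * p) * (p + q) = 2 * p ^ 3 + 2 * p := by linear_combination 2 * p * hpq
  rw [this]
  have := pow_pos hp 3
  linarith

theorem gradient_exponential_decay {n : ℕ} (hn1 : 1 ≤ n)
    (u : EuclideanSpace ℝ (Fin n) → ℝ) (hu : IsACSolution u) (a : ℝ)
    (hmodica : ∀ x, ‖gradient u x‖ ^ 2 ≤ (1 - (u x) ^ 2) ^ 2 / 2)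
    (hbound : ∀ x : EuclideanSpace ℝ (Fin n),
      -1 < u x ∧ u x ≤ H (x ⟨n - 1, by omega⟩ + a)) :
    ∀ x : EuclideanSpace ℝ (Fin n),
      ‖gradient u x‖ ≤ 2 * Real.sqrt 2 *
        Real.exp (Real.sqrt 2 * (x ⟨n - 1, by omega⟩ + a)) := by
  intro x
  obtain ⟨h1, h2⟩ := hbound x
  have hm := hmodica x
  generalize x ⟨n - 1, _⟩ + a = s at h2 ⊢
  have h3 := one_add_H_le s
  have hlt : u x < 1 := lt_of_le_of_lt h2 (Real.tanh_lt_one _)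
  set E := Real.exp (Real.sqrt 2 * s) with hE
  have hE0 : 0 < E := Real.exp_pos _
  have hs : Real.sqrt 2 ^ 2 = 2 := Real.sq_sqrt (by norm_num)
  refine (pow_le_pow_iff_left₀ (norm_nonneg _) (by positivity) two_ne_zero).1 ?_
  have h4 : 1 - u x ^ 2 ≤ 4 * E := by nlinarith
  have h5 : 0 ≤ 1 - u x ^ 2 := by nlinarith
  have h6 : (1 - u x ^ 2) ^ 2 ≤ (4 * E) ^ 2 := pow_le_pow_left₀ h5 h4 2
  calc _ ≤ _ := hm
    _ ≤ (4 * E) ^ 2 / 2 := by linarith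
    _ = _ := by rw [mul_pow, mul_pow, mul_pow, hs]; ring
end

section
/- Let u be a solution of the Allen–Cahn equation −Δu = u − u³ on ℝ³ such that 0 < u(x) ≤ 1 for every x ∈ ℝⁿ is replaced by: let n ≥ 1 and u be a solution on ℝⁿ with 0 < u(x) ≤ 1 for all x ∈ ℝⁿ. Then u ≡ 1 on ℝⁿ. -/
open scoped RealInnerProductSpace

theorem second_deriv_nonneg_of_isLocalMin {g g' : ℝ → ℝ} {c : ℝ}
    (hg : ∀ t, HasDerivAt g (g' t) t) (hg' : HasDerivAt g' c 0) (hmin : IsLocalMin g 0) :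
    0 ≤ c := by
  by_contra hc
  push Not at hc
  have hd : deriv g = g' := funext fun t => (hg t).deriv
  have h0 : deriv g 0 = 0 := hmin.deriv_eq_zero
  have hdd : deriv (deriv g) 0 = c := by rw [hd]; exact hg'.deriv
  have hmax : IsLocalMax g 0 :=
    isLocalMax_of_deriv_deriv_neg (by rw [hdd]; exact hc) h0 (hg 0).continuousAt
  have hconst : g =ᶠ[nhds 0] fun _ => g 0 := by
    filter_upwards [hmin, hmax] with t h1 h2
    exact le_antisymm h2 h1
  have h1 : deriv g =ᶠ[nhds 0] fun _ => (0 : ℝ) := by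
    have := hconst.deriv
    simpa using this
  have h2 := h1.deriv_eq
  rw [hdd] at h2
  simp at h2
  linarith

theorem line_second {n : ℕ} (u : EuclideanSpace ℝ (Fin n) → ℝ) (hu : ContDiff ℝ 2 u)
    (M R : ℝ) (z y : EuclideanSpace ℝ (Fin n)) (i : Fin n)
    (hmin : IsLocalMin (fun x => M * u x - (R ^ 2 - ‖x - y‖ ^ 2) ^ 2) z) :
    8 * ((z - y) i) ^ 2 - 4 * (R ^ 2 - ‖z - y‖ ^ 2) ≤
      M * fderiv ℝ (fun y => fderiv ℝ u y (EuclideanSpace.single i 1)) z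
        (EuclideanSpace.single i 1) := by
  set e : EuclideanSpace ℝ (Fin n) := EuclideanSpace.single i 1 with he
  have hl : ∀ t : ℝ, HasDerivAt (fun t : ℝ => z + t • e) e t := fun t => by
    simpa using ((hasDerivAt_id t).smul_const e).const_add z
  have hw : ∀ t : ℝ, R ^ 2 - ‖z + t • e - y‖ ^ 2
      = (R ^ 2 - ‖z - y‖ ^ 2) - 2 * t * (z - y) i - t ^ 2 := fun t => by
    have h1 : z + t • e - y = (z - y) + t • e := by abel
    rw [h1, norm_add_sq_real, norm_smul, inner_smul_right, he,
      EuclideanSpace.inner_single_right]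
    simp
    ring
  set w := R ^ 2 - ‖z - y‖ ^ 2 with hwdef
  set b := (z - y) i with hb
  have hdu : Differentiable ℝ u := hu.differentiable (by norm_num)
  have hdu2 : Differentiable ℝ (fun x => fderiv ℝ u x e) :=
    ((hu.fderiv_right (m := 1) (by norm_num)).clm_apply contDiff_const).differentiable
      (by norm_num)
  have key := second_deriv_nonneg_of_isLocalMin
    (g := fun t => M * u (z + t • e) - (w - 2 * t * b - t ^ 2) ^ 2)
    (g' := fun t => M * fderiv ℝ u (z + t • e) e
      - 2 * (w - 2 * t * b - t ^ 2) * (- 2 * b - 2 * t))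
    (c := M * fderiv ℝ (fun x => fderiv ℝ u x e) z e - (8 * b ^ 2 - 4 * w)) ?_ ?_ ?_
  · linarith
  · intro t
    have h1 := ((hdu (z + t • e)).hasFDerivAt.comp_hasDerivAt t (hl t)).const_mul M
    have h2 : HasDerivAt (fun t : ℝ => w - 2 * t * b - t ^ 2) (- 2 * b - 2 * t) t := by
      have := ((((hasDerivAt_id t).const_mul 2).mul_const b).const_sub w).sub
        ((hasDerivAt_id t).pow 2)
      refine HasDerivAt.congr_deriv this ?_
      simp
    have h3 := h1.sub (h2.pow 2)
    refine HasDerivAt.congr_deriv h3 ?_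
    simp
  · have h0 : (z + (0 : ℝ) • e) = z := by simp
    have hF := (hdu2 (z + (0 : ℝ) • e)).hasFDerivAt
    have h1 := (hF.comp_hasDerivAt (0 : ℝ) (hl 0)).const_mul M
    rw [h0] at h1
    have h2 : HasDerivAt (fun t : ℝ => w - 2 * t * b - t ^ 2) (- 2 * b) 0 := by
      have := ((((hasDerivAt_id (0 : ℝ)).const_mul 2).mul_const b).const_sub w).sub
        ((hasDerivAt_id (0 : ℝ)).pow 2)
      refine HasDerivAt.congr_deriv this ?_
      simp
    have h3 : HasDerivAt (fun t : ℝ => - 2 * b - 2 * t) (-2) 0 := by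
      simpa using ((hasDerivAt_id (0 : ℝ)).const_mul 2).const_sub (-2 * b)
    have h4 := h1.sub ((h2.const_mul 2).mul h3)
    refine HasDerivAt.congr_deriv h4 ?_
    ring
  · have hc : ContinuousAt (fun t : ℝ => z + t • e) 0 := (hl 0).continuousAt
    have h0 : (z + (0 : ℝ) • e) = z := by simp
    have := IsMinFilter.comp_tendsto (g := fun t : ℝ => z + t • e) (b := (0 : ℝ))
      (l := nhds z) (l' := nhds 0) (f := fun x => M * u x - (R ^ 2 - ‖x - y‖ ^ 2) ^ 2)
      (by rw [h0]; exact hmin) (by simpa [ContinuousAt] using hc)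
    simp only [Function.comp_def, hw] at this
    exact this

theorem positive_implies_one {n : ℕ} (hn1 : 1 ≤ n)
    (u : EuclideanSpace ℝ (Fin n) → ℝ) (hu : IsACSolution u)
    (hrange : ∀ x, 0 < u x ∧ u x ≤ 1) :
    ∀ x, u x = 1 := by
  obtain ⟨hC, hE⟩ := hu
  intro y
  apply le_antisymm (hrange y).2
  apply le_of_forall_pos_lt_add
  intro s hs
  obtain ⟨R, hR0, hR⟩ : ∃ R : ℝ, 0 < R ∧ (4 * n + 8 : ℝ) ^ 2 < 32 * s * R ^ 2 := by
    have hpos : 0 < (4 * n + 8 : ℝ) ^ 2 / s := by positivity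
    refine ⟨Real.sqrt ((4 * n + 8 : ℝ) ^ 2 / s), Real.sqrt_pos.2 hpos, ?_⟩
    rw [Real.sq_sqrt hpos.le, mul_assoc, mul_div_cancel₀ _ hs.ne']
    nlinarith [show 0 < (4 * n + 8 : ℝ) ^ 2 by positivity]
  have hcont : Continuous (fun x => (R ^ 2 - ‖x - y‖ ^ 2) ^ 2 / u x) := by
    refine Continuous.div (by fun_prop) hC.continuous fun x => (hrange x).1.ne'
  obtain ⟨z, hz, hmax⟩ := (isCompact_closedBall y R).exists_isMaxOn
    ⟨y, Metric.mem_closedBall_self hR0.le⟩ hcont.continuousOn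
  set M := (R ^ 2 - ‖z - y‖ ^ 2) ^ 2 / u z with hM
  have hle : ∀ x ∈ Metric.closedBall y R, (R ^ 2 - ‖x - y‖ ^ 2) ^ 2 ≤ M * u x := fun x hx =>
    (div_le_iff₀ (hrange x).1).1 (hmax hx)
  have hy := hle y (Metric.mem_closedBall_self hR0.le)
  simp only [sub_self, norm_zero] at hy
  have hMz : M * u z = (R ^ 2 - ‖z - y‖ ^ 2) ^ 2 := div_mul_cancel₀ _ (hrange z).1.ne'
  have hMpos : 0 < M := by
    by_contra hcon
    have := (hrange y).1
    have h2 : 0 < (R ^ 2 - 0 ^ 2) ^ 2 := by simp; positivity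
    nlinarith
  rw [mem_closedBall_iff_norm] at hz
  have hw0 : R ^ 2 - ‖z - y‖ ^ 2 ≠ 0 := by
    intro h0
    rw [h0] at hMz
    have := mul_pos hMpos (hrange z).1
    linarith
  have hlt : ‖z - y‖ < R := lt_of_le_of_ne hz fun h => hw0 (by rw [h]; ring)
  have hmin : IsLocalMin (fun x => M * u x - (R ^ 2 - ‖x - y‖ ^ 2) ^ 2) z := by
    have : Metric.closedBall y R ∈ nhds z :=
      Filter.mem_of_superset (Metric.isOpen_ball.mem_nhds (mem_ball_iff_norm.2 hlt))
        Metric.ball_subset_closedBall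
    filter_upwards [this] with x hx
    have := hle x hx
    linarith
  have hsum : 8 * ‖z - y‖ ^ 2 - 4 * n * (R ^ 2 - ‖z - y‖ ^ 2) ≤ M * laplacian u z := by
    have := Finset.sum_le_sum fun i (_ : i ∈ Finset.univ) =>
      line_second u hC M R z y i hmin
    rw [← Finset.mul_sum, Finset.sum_sub_distrib, ← Finset.mul_sum] at this
    have hn : ‖z - y‖ ^ 2 = ∑ i, ((z - y) i) ^ 2 := EuclideanSpace.real_norm_sq_eq _
    rw [← hn] at this
    simp only [Finset.sum_const, Finset.card_univ, Fintype.card_fin, nsmul_eq_mul] at this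
    unfold laplacian
    linarith
  have hEz := hE z
  have hL : M * laplacian u z = -(R ^ 2 - ‖z - y‖ ^ 2) ^ 2 * (1 - u z ^ 2) := by
    rw [← hMz]
    linear_combination (-M) * hEz
  rw [hL] at hsum
  have hq : ‖z - y‖ ^ 2 = R ^ 2 - (R ^ 2 - ‖z - y‖ ^ 2) := by ring
  have hwle : R ^ 2 - ‖z - y‖ ^ 2 ≤ R ^ 2 := by nlinarith [sq_nonneg ‖z - y‖]
  have hwpos : 0 < R ^ 2 - ‖z - y‖ ^ 2 := by nlinarith [norm_nonneg (z - y)]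
  generalize hw : R ^ 2 - ‖z - y‖ ^ 2 = w at *
  rw [hq] at hsum
  have hus : 1 - u z ^ 2 < s := by
    by_contra hcon
    push Not at hcon
    have h1 : s * w ^ 2 ≤ (1 - u z ^ 2) * w ^ 2 := by gcongr
    have h2 : s * w ^ 2 - (4 * n + 8) * w + 8 * R ^ 2 ≤ 0 := by linarith
    nlinarith [sq_nonneg (2 * s * w - (4 * n + 8))]
  have hzy : u z ≤ u y := by
    have h1 : M * u z ≤ M * u y := by
      rw [hMz]
      calc w ^ 2 ≤ (R ^ 2) ^ 2 := by gcongr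
        _ ≤ _ := by simpa using hy
    exact le_of_mul_le_mul_left h1 hMpos
  have := hrange z
  nlinarith
end

section
/- Let u be a solution of the Allen–Cahn equation −Δu = u − u³ on ℝ³ such that there exists C > 0 with |∇u(x)| ≤ C·e^{√2 x₃} for all x ∈ ℝ³, and such that u(x) → −1 as x₃ → −∞ uniformly in (x₁, x₂). Then for every s > 0 and every A ∈ ℝ the following balancing (Pohozaev-type) identity holds: ∫_{x₁²+x₂²<s²} ( |∇u(x₁,x₂,−A)|²/2 + (1 − u(x₁,x₂,−A)²)²/4 − (∂₃u(x₁,x₂,−A))² ) dx₁ dx₂ = s ∫_{−∞}^{−A} ∫₀^{2π} (cos θ · ∂₁u + sin θ · ∂₂u)(s cos θ, s sin θ, x₃) · ∂₃u(s cos θ, s sin θ, x₃) dθ dx₃, where both integrals converge absolutely. -/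
open scoped RealInnerProductSpace

/-- The point `(a, b, c)` of `ℝ³`. -/
noncomputable def pt (a b c : ℝ) : EuclideanSpace ℝ (Fin 3) :=
  (WithLp.equiv 2 (Fin 3 → ℝ)).symm ![a, b, c]

/-- The `i`-th partial derivative of `u : ℝ³ → ℝ`. -/
noncomputable def pd (u : EuclideanSpace ℝ (Fin 3) → ℝ) (i : Fin 3)
    (x : EuclideanSpace ℝ (Fin 3)) : ℝ :=
  fderiv ℝ u x (EuclideanSpace.single i 1)

lemma pt_eq (a b c : ℝ) : pt a b c = a • EuclideanSpace.single 0 (1:ℝ)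
    + b • EuclideanSpace.single 1 (1:ℝ) + c • EuclideanSpace.single 2 (1:ℝ) := by
  ext i
  fin_cases i <;> simp [pt]

lemma pt_two (a b c : ℝ) : (pt a b c) 2 = c := by simp [pt]

lemma contDiff_pt {F : Type*} [NormedAddCommGroup F] [NormedSpace ℝ F] {n : ℕ∞}
    {a b c : F → ℝ} (ha : ContDiff ℝ n a) (hb : ContDiff ℝ n b) (hc : ContDiff ℝ n c) :
    ContDiff ℝ n (fun t => pt (a t) (b t) (c t)) := by
  simp only [pt_eq]
  fun_prop

lemma continuous_pt {F : Type*} [TopologicalSpace F]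
    {a b c : F → ℝ} (ha : Continuous a) (hb : Continuous b) (hc : Continuous c) :
    Continuous (fun t => pt (a t) (b t) (c t)) := by
  simp only [pt_eq]
  fun_prop

lemma chain_pt (φ : EuclideanSpace ℝ (Fin 3) → ℝ) (hφ : Differentiable ℝ φ)
    {a b c : ℝ → ℝ} {a' b' c' t : ℝ} (ha : HasDerivAt a a' t) (hb : HasDerivAt b b' t)
    (hc : HasDerivAt c c' t) :
    HasDerivAt (fun t => φ (pt (a t) (b t) (c t)))
      (a' * pd φ 0 (pt (a t) (b t) (c t)) + b' * pd φ 1 (pt (a t) (b t) (c t))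
        + c' * pd φ 2 (pt (a t) (b t) (c t))) t := by
  have h1 : HasDerivAt (fun t => pt (a t) (b t) (c t)) (pt a' b' c') t := by
    simp only [pt_eq]
    exact ((ha.smul_const _).add (hb.smul_const _)).add (hc.smul_const _)
  have h2 := (hφ (pt (a t) (b t) (c t))).hasFDerivAt.comp_hasDerivAt t h1
  have e : fderiv ℝ φ (pt (a t) (b t) (c t)) (pt a' b' c') =
      a' * pd φ 0 (pt (a t) (b t) (c t)) + b' * pd φ 1 (pt (a t) (b t) (c t))
        + c' * pd φ 2 (pt (a t) (b t) (c t)) := by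
    rw [pt_eq a' b' c']
    simp [pd]
  rw [e] at h2
  exact h2

lemma contDiff_pd {u : EuclideanSpace ℝ (Fin 3) → ℝ} (hu : ContDiff ℝ 2 u) (i : Fin 3) :
    ContDiff ℝ 1 (pd u i) := by
  unfold pd
  have h : ContDiff ℝ 1 (fderiv ℝ u) := hu.fderiv_right (by norm_num)
  exact h.clm_apply contDiff_const

lemma pd_symm {u : EuclideanSpace ℝ (Fin 3) → ℝ} (hu : ContDiff ℝ 2 u) (i j : Fin 3)
    (x : EuclideanSpace ℝ (Fin 3)) : pd (pd u i) j x = pd (pd u j) i x := by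
  have h : ContDiff ℝ 1 (fderiv ℝ u) := hu.fderiv_right (by norm_num)
  have key : ∀ i j : Fin 3, pd (pd u i) j x = fderiv ℝ (fderiv ℝ u) x
      (EuclideanSpace.single j 1) (EuclideanSpace.single i 1) := by
    intro i j
    have h3 := ((h.differentiable one_ne_zero x).hasFDerivAt).clm_apply
      (hasFDerivAt_const (EuclideanSpace.single i (1:ℝ)) x)
    have h4 : pd u i = fun y => fderiv ℝ u y (EuclideanSpace.single i 1) := rfl
    rw [pd, h4, h3.fderiv]
    simp
  rw [key, key]
  exact (hu.contDiffAt.isSymmSndFDerivAt (by simp)) _ _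

lemma norm_grad_sq (u : EuclideanSpace ℝ (Fin 3) → ℝ)
    (x : EuclideanSpace ℝ (Fin 3)) :
    ‖gradient u x‖ ^ 2 = pd u 0 x ^ 2 + pd u 1 x ^ 2 + pd u 2 x ^ 2 := by
  have h : ∀ i, gradient u x i = pd u i x := by
    intro i
    have : inner ℝ (gradient u x) (EuclideanSpace.single i (1:ℝ)) = pd u i x := by
      unfold gradient pd
      rw [InnerProductSpace.toDual_symm_apply]
    rw [EuclideanSpace.inner_single_right] at this
    simpa using this
  rw [EuclideanSpace.norm_sq_eq, Fin.sum_univ_three]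
  simp [h]

open MeasureTheory Set in
lemma integral_fin_two (a b : Fin 2 → ℝ) (h : (Fin 2 → ℝ) → ℝ) :
    ∫ x in Icc a b, h x =
      ∫ p in Icc (a 0) (b 0) ×ˢ Icc (a 1) (b 1), h ![p.1, p.2] := by
  have mp := (volume_preserving_finTwoArrow ℝ).symm
  rw [← mp.setIntegral_preimage_emb (MeasurableEquiv.measurableEmbedding _)]
  have : (MeasurableEquiv.finTwoArrow (α := ℝ)).symm ⁻¹' Icc a b
      = Icc (a 0) (b 0) ×ˢ Icc (a 1) (b 1) := by
    ext p
    simp [Pi.le_def, Fin.forall_fin_two, MeasurableEquiv.finTwoArrow, Prod.le_def]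
  rw [this]
  rfl

/-- The third component of the stress field. -/
noncomputable def gg (u : EuclideanSpace ℝ (Fin 3) → ℝ) (x : EuclideanSpace ℝ (Fin 3)) : ℝ :=
  (pd u 0 x ^ 2 + pd u 1 x ^ 2 - pd u 2 x ^ 2) / 2 + (1 - u x ^ 2) ^ 2 / 4

/-- The flux density through the lateral boundary. -/
noncomputable def ff (u : EuclideanSpace ℝ (Fin 3) → ℝ) (r z θ : ℝ) : ℝ :=
  (Real.cos θ * pd u 0 (pt (r * Real.cos θ) (r * Real.sin θ) z)
    + Real.sin θ * pd u 1 (pt (r * Real.cos θ) (r * Real.sin θ) z))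
    * pd u 2 (pt (r * Real.cos θ) (r * Real.sin θ) z)

/-- The field in cylindrical coordinates `(z, r, θ)`. -/
noncomputable def cyl (u : EuclideanSpace ℝ (Fin 3) → ℝ) (v : Fin 3 → ℝ) : Fin 3 → ℝ :=
  ![v 1 * gg u (pt (v 1 * Real.cos (v 2)) (v 1 * Real.sin (v 2)) (v 0)),
    - (v 1 * ff u (v 1) (v 0) (v 2)),
    - ((Real.cos (v 2) * pd u 1 (pt (v 1 * Real.cos (v 2)) (v 1 * Real.sin (v 2)) (v 0))
      - Real.sin (v 2) * pd u 0 (pt (v 1 * Real.cos (v 2)) (v 1 * Real.sin (v 2)) (v 0)))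
      * pd u 2 (pt (v 1 * Real.cos (v 2)) (v 1 * Real.sin (v 2)) (v 0)))]

lemma contDiff_gg {u : EuclideanSpace ℝ (Fin 3) → ℝ} (hu : ContDiff ℝ 2 u) :
    ContDiff ℝ 1 (gg u) := by
  have h0 := contDiff_pd hu 0
  have h1 := contDiff_pd hu 1
  have h2 := contDiff_pd hu 2
  have h3 : ContDiff ℝ 1 u := hu.of_le (by norm_num)
  unfold gg
  fun_prop

lemma contDiff_cyl {u : EuclideanSpace ℝ (Fin 3) → ℝ} (hu : ContDiff ℝ 2 u) :
    ContDiff ℝ 1 (cyl u) := by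
  have hX : ContDiff ℝ 1 (fun v : Fin 3 → ℝ =>
      pt (v 1 * Real.cos (v 2)) (v 1 * Real.sin (v 2)) (v 0)) := by
    apply contDiff_pt (n := 1) <;> fun_prop
  have h0 := (contDiff_pd hu 0).comp hX
  have h1 := (contDiff_pd hu 1).comp hX
  have h2 := (contDiff_pd hu 2).comp hX
  have h3 := (contDiff_gg hu).comp hX
  simp only [Function.comp_def] at h0 h1 h2 h3
  rw [contDiff_pi]
  intro i
  fin_cases i
  · simp only [cyl, Fin.zero_eta, Matrix.cons_val_zero]
    fun_prop
  · simp only [cyl, ff, Fin.mk_one, Matrix.cons_val_one, Matrix.cons_val_zero]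
    fun_prop
  · simp only [cyl, Fin.reduceFinMk, Matrix.cons_val]
    fun_prop

lemma cyl_div_aux {u : EuclideanSpace ℝ (Fin 3) → ℝ} (hu : ContDiff ℝ 2 u) (v : Fin 3 → ℝ)
    (i : Fin 3) : HasDerivAt (fun t => cyl u (Function.update v i t) i)
      (fderiv ℝ (cyl u) v (Pi.single i 1) i) (v i) := by
  have h := ((contDiff_cyl hu).differentiable one_ne_zero v).hasFDerivAt
  rw [hasFDerivAt_pi'] at h
  have h1 := h i
  have h2 := hasDerivAt_update v i (v i)
  have h3 : HasFDerivAt (fun x => cyl u x i)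
    ((ContinuousLinearMap.proj i).comp (fderiv ℝ (cyl u) v)) (Function.update v i (v i)) := by
    simpa using h1
  have h4 := h3.comp_hasDerivAt (v i) h2
  rw [ContinuousLinearMap.comp_apply] at h4
  exact h4

lemma cyl_div {u : EuclideanSpace ℝ (Fin 3) → ℝ} (hu : IsACSolution u) (v : Fin 3 → ℝ) :
    ∑ i, fderiv ℝ (cyl u) v (Pi.single i 1) i = 0 := by
  obtain ⟨hc, hpde⟩ := hu
  have d : ∀ i, Differentiable ℝ (pd u i) := fun i =>
    (contDiff_pd hc i).differentiable one_ne_zero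
  have du : Differentiable ℝ u := hc.differentiable two_ne_zero
  set z := v 0 with hz
  set r := v 1 with hr
  set θ := v 2 with hθ
  set X := pt (r * Real.cos θ) (r * Real.sin θ) z with hX
  have lap : pd (pd u 0) 0 X + pd (pd u 1) 1 X + pd (pd u 2) 2 X = u X ^ 3 - u X := by
    have := hpde X
    rw [laplacian, Fin.sum_univ_three] at this
    change -(pd (pd u 0) 0 X + pd (pd u 1) 1 X + pd (pd u 2) 2 X) = _ at this
    linarith
  have s01 := pd_symm hc 0 1 X
  have s02 := pd_symm hc 0 2 X
  have s12 := pd_symm hc 1 2 X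
  -- z derivative
  have cz : ∀ φ : EuclideanSpace ℝ (Fin 3) → ℝ, Differentiable ℝ φ →
      HasDerivAt (fun t => φ (pt (r * Real.cos θ) (r * Real.sin θ) t)) (pd φ 2 X) z := by
    intro φ hφ
    have := chain_pt φ hφ (hasDerivAt_const z (r * Real.cos θ))
      (hasDerivAt_const z (r * Real.sin θ)) (hasDerivAt_id z)
    simpa using this
  have cr : ∀ φ : EuclideanSpace ℝ (Fin 3) → ℝ, Differentiable ℝ φ →
      HasDerivAt (fun t => φ (pt (t * Real.cos θ) (t * Real.sin θ) z))
        (Real.cos θ * pd φ 0 X + Real.sin θ * pd φ 1 X) r := by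
    intro φ hφ
    have := chain_pt φ hφ ((hasDerivAt_id r).mul_const (Real.cos θ))
      ((hasDerivAt_id r).mul_const (Real.sin θ)) (hasDerivAt_const r z)
    simpa using this
  have cθ : ∀ φ : EuclideanSpace ℝ (Fin 3) → ℝ, Differentiable ℝ φ →
      HasDerivAt (fun t => φ (pt (r * Real.cos t) (r * Real.sin t) z))
        (-(r * Real.sin θ) * pd φ 0 X + r * Real.cos θ * pd φ 1 X) θ := by
    intro φ hφ
    have := chain_pt φ hφ ((Real.hasDerivAt_cos θ).const_mul r)
      ((Real.hasDerivAt_sin θ).const_mul r) (hasDerivAt_const θ z)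
    simpa using this
  have e0 := (cyl_div_aux hc v 0).unique (f := fun t => cyl u (Function.update v 0 t) 0)
    (f₁' := r * ((2 * pd u 0 X * pd (pd u 0) 2 X + 2 * pd u 1 X * pd (pd u 1) 2 X
      - 2 * pd u 2 X * pd (pd u 2) 2 X) / 2 - (1 - u X ^ 2) * u X * pd u 2 X)) (by
      simp only [cyl, gg, Matrix.cons_val_zero, Function.update_self,
        Function.update_of_ne (show (1 : Fin 3) ≠ 0 by decide),
        Function.update_of_ne (show (2 : Fin 3) ≠ 0 by decide)]
      have := ((((((cz _ (d 0)).pow 2).add ((cz _ (d 1)).pow 2)).sub ((cz _ (d 2)).pow 2)).div_const 2).add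
        (((((cz u du).pow 2).const_sub 1).pow 2).div_const 4)).const_mul r
      refine this.congr_deriv ?_
      simp only [Pi.pow_apply, ← hX]
      ring)
  have e1 := (cyl_div_aux hc v 1).unique (f := fun t => cyl u (Function.update v 1 t) 1)
    (f₁' := -((Real.cos θ * pd u 0 X + Real.sin θ * pd u 1 X) * pd u 2 X
      + r * ((Real.cos θ * (Real.cos θ * pd (pd u 0) 0 X + Real.sin θ * pd (pd u 0) 1 X)
        + Real.sin θ * (Real.cos θ * pd (pd u 1) 0 X + Real.sin θ * pd (pd u 1) 1 X)) * pd u 2 X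
        + (Real.cos θ * pd u 0 X + Real.sin θ * pd u 1 X) *
          (Real.cos θ * pd (pd u 2) 0 X + Real.sin θ * pd (pd u 2) 1 X)))) (by
      simp only [cyl, ff, Matrix.cons_val_one, Matrix.cons_val_zero, Function.update_self,
        Function.update_of_ne (show (0 : Fin 3) ≠ 1 by decide),
        Function.update_of_ne (show (2 : Fin 3) ≠ 1 by decide)]
      have := ((hasDerivAt_id r).mul ((((cr _ (d 0)).const_mul (Real.cos θ)).add
        ((cr _ (d 1)).const_mul (Real.sin θ))).mul (cr _ (d 2)))).neg
      refine this.congr_deriv ?_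
      simp only [Pi.mul_apply, Pi.add_apply, id, ← hX]
      ring)
  have e2 := (cyl_div_aux hc v 2).unique (f := fun t => cyl u (Function.update v 2 t) 2)
    (f₁' := -((-Real.sin θ * pd u 1 X + Real.cos θ *
        (-(r * Real.sin θ) * pd (pd u 1) 0 X + r * Real.cos θ * pd (pd u 1) 1 X)
      - (Real.cos θ * pd u 0 X + Real.sin θ *
        (-(r * Real.sin θ) * pd (pd u 0) 0 X + r * Real.cos θ * pd (pd u 0) 1 X))) * pd u 2 X
      + (Real.cos θ * pd u 1 X - Real.sin θ * pd u 0 X) *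
        (-(r * Real.sin θ) * pd (pd u 2) 0 X + r * Real.cos θ * pd (pd u 2) 1 X))) (by
      simp only [cyl, Matrix.cons_val, Function.update_self,
        Function.update_of_ne (show (0 : Fin 3) ≠ 2 by decide),
        Function.update_of_ne (show (1 : Fin 3) ≠ 2 by decide)]
      have := ((((Real.hasDerivAt_cos θ).mul (cθ _ (d 1))).sub
        ((Real.hasDerivAt_sin θ).mul (cθ _ (d 0)))).mul (cθ _ (d 2))).neg
      refine this.congr_deriv ?_
      simp only [Pi.mul_apply, Pi.sub_apply, ← hX])
  rw [Fin.sum_univ_three, e0, e1, e2, s01, s02, s12]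
  have cs := Real.cos_sq_add_sin_sq θ
  have l2 : pd (pd u 2) 2 X = u X ^ 3 - u X - pd (pd u 0) 0 X - pd (pd u 1) 1 X := by linarith
  rw [l2]
  have c2 : Real.cos θ ^ 2 = 1 - Real.sin θ ^ 2 := by linarith
  ring_nf
  simp only [c2]
  ring

open MeasureTheory Set in
lemma box_identity {u : EuclideanSpace ℝ (Fin 3) → ℝ} (hu : IsACSolution u) {s z₀ z₁ : ℝ}
    (hs : 0 < s) (hz : z₀ ≤ z₁) :
    (∫ p in Icc 0 s ×ˢ Icc (-Real.pi) Real.pi,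
        p.1 * gg u (pt (p.1 * Real.cos p.2) (p.1 * Real.sin p.2) z₁))
      - (∫ p in Icc 0 s ×ˢ Icc (-Real.pi) Real.pi,
        p.1 * gg u (pt (p.1 * Real.cos p.2) (p.1 * Real.sin p.2) z₀))
      = s * ∫ q in Icc z₀ z₁ ×ˢ Icc (-Real.pi) Real.pi, ff u s q.1 q.2 := by
  have hc := contDiff_cyl hu.1
  have key := integral_divergence_of_hasFDerivAt_off_countable (n := 2)
    (![z₀, 0, -Real.pi] : Fin 3 → ℝ) ![z₁, s, Real.pi]
    (by
      intro i
      fin_cases i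
      · exact hz
      · exact hs.le
      · simp [Real.pi_pos.le])
    (cyl u) (fun v => fderiv ℝ (cyl u) v) ∅ countable_empty hc.continuous.continuousOn
    (fun x _ => (hc.differentiable one_ne_zero x).hasFDerivAt)
    (by simp only [cyl_div hu]; exact integrableOn_zero)
  simp only [cyl_div hu, integral_zero, integral_fin_two] at key
  rw [Fin.sum_univ_three] at key
  simp [cyl, Fin.succAbove, Fin.insertNth, Fin.succAboveCases] at key
  rw [integral_neg, integral_const_mul] at key
  simp only [Icc_prod_Icc]
  linarith

lemma abs_pd_le (u : EuclideanSpace ℝ (Fin 3) → ℝ) (i : Fin 3) (x : EuclideanSpace ℝ (Fin 3)) :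
    |pd u i x| ≤ ‖gradient u x‖ := by
  have h := norm_grad_sq u x
  apply abs_le_of_sq_le_sq _ (norm_nonneg _)
  rw [h]
  have n0 := sq_nonneg (pd u 0 x)
  have n1 := sq_nonneg (pd u 1 x)
  have n2 := sq_nonneg (pd u 2 x)
  fin_cases i <;> simp only [Fin.zero_eta, Fin.mk_one, Fin.reduceFinMk] <;> linarith

lemma continuous_ff {u : EuclideanSpace ℝ (Fin 3) → ℝ} (hu : ContDiff ℝ 2 u) (s : ℝ) :
    Continuous (fun q : ℝ × ℝ => ff u s q.1 q.2) := by
  have hX : Continuous (fun q : ℝ × ℝ => pt (s * Real.cos q.2) (s * Real.sin q.2) q.1) := by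
    apply continuous_pt <;> fun_prop
  have h0 := (contDiff_pd hu 0).continuous.comp hX
  have h1 := (contDiff_pd hu 1).continuous.comp hX
  have h2 := (contDiff_pd hu 2).continuous.comp hX
  simp only [Function.comp_def] at h0 h1 h2
  unfold ff
  fun_prop

lemma abs_ff_le {u : EuclideanSpace ℝ (Fin 3) → ℝ} {C : ℝ}
    (hgrad : ∀ x : EuclideanSpace ℝ (Fin 3),
      ‖gradient u x‖ ≤ C * Real.exp (Real.sqrt 2 * x 2)) (s z θ : ℝ) :
    |ff u s z θ| ≤ 2 * C ^ 2 * Real.exp (2 * Real.sqrt 2 * z) := by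
  set X := pt (s * Real.cos θ) (s * Real.sin θ) z with hX
  set M := C * Real.exp (Real.sqrt 2 * z) with hM
  have hb : ∀ i, |pd u i X| ≤ M := fun i => by
    refine (abs_pd_le u i X).trans ((hgrad X).trans_eq ?_)
    rw [hX, pt_two]
  have hM0 : 0 ≤ M := (abs_nonneg _).trans (hb 0)
  have e : 2 * C ^ 2 * Real.exp (2 * Real.sqrt 2 * z) = (M + M) * M := by
    rw [hM, show 2 * Real.sqrt 2 * z = Real.sqrt 2 * z + Real.sqrt 2 * z by ring, Real.exp_add]
    ring
  rw [e]
  unfold ff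
  rw [abs_mul]
  refine mul_le_mul ?_ (hb 2) (abs_nonneg _) (by positivity)
  refine (abs_add_le _ _).trans (add_le_add ?_ ?_)
  · rw [abs_mul]
    exact (mul_le_of_le_one_left (abs_nonneg _) (Real.abs_cos_le_one θ)).trans (hb 0)
  · rw [abs_mul]
    exact (mul_le_of_le_one_left (abs_nonneg _) (Real.abs_sin_le_one θ)).trans (hb 1)

open MeasureTheory Set in
lemma integrable_ff {u : EuclideanSpace ℝ (Fin 3) → ℝ} (hu : ContDiff ℝ 2 u) {C : ℝ}
    (hgrad : ∀ x : EuclideanSpace ℝ (Fin 3),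
      ‖gradient u x‖ ≤ C * Real.exp (Real.sqrt 2 * x 2)) (s z a b : ℝ) :
    IntegrableOn (fun q : ℝ × ℝ => ff u s q.1 q.2) (Iic z ×ˢ Icc a b) := by
  have h1 : IntegrableOn (fun t : ℝ => Real.exp (2 * Real.sqrt 2 * t)) (Iic z) :=
    integrableOn_exp_mul_Iic (by positivity) z
  have h2 : IntegrableOn (fun _ : ℝ => 2 * C ^ 2) (Icc a b) := by
    apply Continuous.integrableOn_Icc; fun_prop
  have h3 := Integrable.mul_prod h1 h2
  rw [Measure.prod_restrict] at h3
  refine Integrable.mono' (μ := volume.restrict _) h3 (continuous_ff hu s).aestronglyMeasurable ?_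
  refine Filter.Eventually.of_forall fun q => ?_
  rw [Real.norm_eq_abs]
  refine (abs_ff_le hgrad s q.1 q.2).trans_eq ?_
  ring

open MeasureTheory Set in
lemma ff_period {u : EuclideanSpace ℝ (Fin 3) → ℝ} (hu : ContDiff ℝ 2 u) {C : ℝ}
    (hgrad : ∀ x : EuclideanSpace ℝ (Fin 3),
      ‖gradient u x‖ ≤ C * Real.exp (Real.sqrt 2 * x 2)) (s z : ℝ) :
    ∫ q in Iio z ×ˢ Ioc 0 (2 * Real.pi), ff u s q.1 q.2
      = ∫ q in Iic z ×ˢ Icc (-Real.pi) Real.pi, ff u s q.1 q.2 := by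
  have e1 : (Iio z ×ˢ Ioc 0 (2 * Real.pi) : Set (ℝ × ℝ)) =ᵐ[volume]
      Iic z ×ˢ Icc 0 (2 * Real.pi) :=
    Measure.set_prod_ae_eq Iio_ae_eq_Iic Ioc_ae_eq_Icc
  rw [setIntegral_congr_set e1]
  have f1 := setIntegral_prod (μ := (volume : Measure ℝ)) (ν := (volume : Measure ℝ)) _
    (integrable_ff hu hgrad s z 0 (2 * Real.pi))
  have f2 := setIntegral_prod (μ := (volume : Measure ℝ)) (ν := (volume : Measure ℝ)) _
    (integrable_ff hu hgrad s z (-Real.pi) Real.pi)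
  refine f1.trans (Eq.trans ?_ f2.symm)
  congr 1
  ext t
  have hp : Function.Periodic (fun θ => ff u s t θ) (2 * Real.pi) := by
    intro θ
    simp [ff]
  have := hp.intervalIntegral_add_eq 0 (-Real.pi)
  have e : -Real.pi + 2 * Real.pi = Real.pi := by ring
  have pp := Real.pi_pos
  rw [e, zero_add, intervalIntegral.integral_of_le (by positivity),
    intervalIntegral.integral_of_le (by linarith)] at this
  rw [integral_Icc_eq_integral_Ioc, integral_Icc_eq_integral_Ioc]
  exact this

open MeasureTheory Set in
lemma polar_gg (u : EuclideanSpace ℝ (Fin 3) → ℝ) {s : ℝ} (hs : 0 < s) (z : ℝ) :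
    ∫ p in {p : ℝ × ℝ | p.1 ^ 2 + p.2 ^ 2 < s ^ 2}, gg u (pt p.1 p.2 z)
      = ∫ p in Icc 0 s ×ˢ Icc (-Real.pi) Real.pi,
        p.1 * gg u (pt (p.1 * Real.cos p.2) (p.1 * Real.sin p.2) z) := by
  have hm : MeasurableSet {p : ℝ × ℝ | p.1 ^ 2 + p.2 ^ 2 < s ^ 2} :=
    (isOpen_lt (by fun_prop) (by fun_prop)).measurableSet
  rw [← integral_indicator hm, ← integral_comp_polarCoord_symm]
  have e1 : (Ioo 0 s ×ˢ Ioo (-Real.pi) Real.pi : Set (ℝ × ℝ)) =ᵐ[volume]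
      Icc 0 s ×ˢ Icc (-Real.pi) Real.pi :=
    Measure.set_prod_ae_eq Ioo_ae_eq_Icc Ioo_ae_eq_Icc
  rw [← setIntegral_congr_set e1]
  have ht : polarCoord.target = Ioi 0 ×ˢ Ioo (-Real.pi) Real.pi := rfl
  rw [ht]
  have hm2 : MeasurableSet (Ioo 0 s ×ˢ Ioo (-Real.pi) Real.pi : Set (ℝ × ℝ)) :=
    measurableSet_Ioo.prod measurableSet_Ioo
  have hm3 : MeasurableSet (Ioi 0 ×ˢ Ioo (-Real.pi) Real.pi : Set (ℝ × ℝ)) :=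
    measurableSet_Ioi.prod measurableSet_Ioo
  rw [← integral_indicator hm2, ← integral_indicator hm3]
  congr 1
  ext p
  have hsq : (p.1 * Real.cos p.2) ^ 2 + (p.1 * Real.sin p.2) ^ 2 = p.1 ^ 2 := by
    have := Real.cos_sq_add_sin_sq p.2
    linear_combination p.1 ^ 2 * this
  by_cases h1 : p ∈ (Ioi 0 ×ˢ Ioo (-Real.pi) Real.pi : Set (ℝ × ℝ))
  · rw [indicator_of_mem h1]
    have hp : 0 < p.1 := h1.1
    by_cases h2 : p.1 < s
    · rw [indicator_of_mem (show p ∈ Ioo 0 s ×ˢ Ioo (-Real.pi) Real.pi from ⟨⟨hp, h2⟩, h1.2⟩),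
        indicator_of_mem]
      · simp
      · simp only [mem_ofPred_eq, polarCoord_symm_apply]
        rw [hsq]
        exact pow_lt_pow_left₀ h2 hp.le two_ne_zero
    · rw [indicator_of_notMem (fun h : p ∈ Ioo 0 s ×ˢ Ioo (-Real.pi) Real.pi => h2 h.1.2),
        indicator_of_notMem]
      · simp
      · simp only [mem_ofPred_eq, polarCoord_symm_apply]
        rw [hsq]
        exact not_lt.2 (pow_le_pow_left₀ hs.le (not_lt.1 h2) 2)
  · rw [indicator_of_notMem h1, indicator_of_notMem]
    exact fun h => h1 ⟨h.1.1, h.2⟩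

open MeasureTheory Set Filter Topology in
lemma tendsto_gg {u : EuclideanSpace ℝ (Fin 3) → ℝ} {C : ℝ}
    (hgrad : ∀ x : EuclideanSpace ℝ (Fin 3),
      ‖gradient u x‖ ≤ C * Real.exp (Real.sqrt 2 * x 2))
    (hlim : ∀ ε : ℝ, 0 < ε → ∃ R : ℝ, 0 < R ∧
      ∀ x : EuclideanSpace ℝ (Fin 3), x 2 ≤ -R → |u x + 1| ≤ ε) {δ : ℝ} (hδ : 0 < δ) :
    ∀ᶠ z in atBot, ∀ a b, |gg u (pt a b z)| ≤ δ := by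
  have t1 : Tendsto (fun z : ℝ => 3 / 2 * (C * Real.exp (Real.sqrt 2 * z)) ^ 2) atBot (𝓝 0) := by
    have h1 : Tendsto (fun z : ℝ => Real.sqrt 2 * z) atBot atBot :=
      tendsto_id.const_mul_atBot (by positivity)
    have h2 := (((Real.tendsto_exp_atBot.comp h1).const_mul C).pow 2).const_mul (3 / 2)
    simpa using h2
  obtain ⟨R, hR, hu⟩ := hlim (min 1 (δ / 8)) (by positivity)
  filter_upwards [t1.eventually (ge_mem_nhds (show (0:ℝ) < δ / 4 by positivity)),
    eventually_le_atBot (-R)] with z hz1 hz2 a b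
  set X := pt a b z with hX
  have hX2 : X 2 = z := pt_two a b z
  have hb : ∀ i, pd u i X ^ 2 ≤ (C * Real.exp (Real.sqrt 2 * z)) ^ 2 := fun i => by
    have h := (abs_pd_le u i X).trans (hgrad X)
    rw [hX2] at h
    exact sq_le_sq.2 (h.trans (le_abs_self _))
  have h0 := hb 0
  have h1 := hb 1
  have h2 := hb 2
  have h3 := hu X (hX2.trans_le hz2)
  have h4 : |u X + 1| ≤ 1 := h3.trans (min_le_left _ _)
  have h5 : |u X + 1| ≤ δ / 8 := h3.trans (min_le_right _ _)
  have h6 : (1 - u X ^ 2) ^ 2 / 4 ≤ δ / 2 := by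
    have e : (1 - u X ^ 2) ^ 2 = |u X + 1| * (|u X + 1| * (1 - u X) ^ 2) := by
      have := abs_mul_abs_self (u X + 1)
      linear_combination -(1 - u X) ^ 2 * this
    obtain ⟨l, r⟩ := abs_le.1 h4
    have h7 : (1 - u X) ^ 2 ≤ 9 := by nlinarith
    have h8 : |u X + 1| * (1 - u X) ^ 2 ≤ 1 * 9 :=
      mul_le_mul h4 h7 (by positivity) (by norm_num)
    have h9 : |u X + 1| * (|u X + 1| * (1 - u X) ^ 2) ≤ δ / 8 * (1 * 9) :=
      mul_le_mul h5 h8 (by positivity) (by positivity)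
    rw [e]; linarith
  have h7 : 0 ≤ (1 - u X ^ 2) ^ 2 / 4 := by positivity
  have n0 := sq_nonneg (pd u 0 X)
  have n1 := sq_nonneg (pd u 1 X)
  have n2 := sq_nonneg (pd u 2 X)
  unfold gg
  rw [abs_le]
  constructor <;> linarith

open MeasureTheory Set Filter Topology in
lemma tendsto_int_gg {u : EuclideanSpace ℝ (Fin 3) → ℝ} {C : ℝ}
    (hgrad : ∀ x : EuclideanSpace ℝ (Fin 3),
      ‖gradient u x‖ ≤ C * Real.exp (Real.sqrt 2 * x 2))
    (hlim : ∀ ε : ℝ, 0 < ε → ∃ R : ℝ, 0 < R ∧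
      ∀ x : EuclideanSpace ℝ (Fin 3), x 2 ≤ -R → |u x + 1| ≤ ε) {s : ℝ} (hs : 0 < s) :
    Tendsto (fun z => ∫ p in Icc 0 s ×ˢ Icc (-Real.pi) Real.pi,
        p.1 * gg u (pt (p.1 * Real.cos p.2) (p.1 * Real.sin p.2) z)) atBot (𝓝 0) := by
  rw [Metric.tendsto_nhds]
  intro ε hε
  set m := volume.real (Icc 0 s ×ˢ Icc (-Real.pi) Real.pi : Set (ℝ × ℝ)) with hm
  have hm0 : 0 ≤ m := measureReal_nonneg
  have hδ : 0 < ε / (2 * s * (m + 1)) := by positivity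
  filter_upwards [tendsto_gg hgrad hlim hδ] with z hz
  rw [dist_zero_right]
  have hfin : volume (Icc 0 s ×ˢ Icc (-Real.pi) Real.pi : Set (ℝ × ℝ)) < ⊤ :=
    (isCompact_Icc.prod isCompact_Icc).measure_lt_top
  have := norm_setIntegral_le_of_norm_le_const hfin
    (f := fun p : ℝ × ℝ => p.1 * gg u (pt (p.1 * Real.cos p.2) (p.1 * Real.sin p.2) z))
    (C := s * (ε / (2 * s * (m + 1)))) (by
      intro p hp
      rw [norm_mul, Real.norm_eq_abs, Real.norm_eq_abs, abs_of_nonneg hp.1.1]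
      exact mul_le_mul hp.1.2 (hz _ _) (abs_nonneg _) hs.le)
  refine this.trans_lt ?_
  rw [← hm]
  have e : s * (ε / (2 * s * (m + 1))) * m = ε * (m / (2 * (m + 1))) := by
    field_simp
  rw [e]
  have : m / (2 * (m + 1)) < 1 := by
    rw [div_lt_one (by positivity)]; linarith
  nlinarith

theorem balancing_formula (u : EuclideanSpace ℝ (Fin 3) → ℝ) (hu : IsACSolution u)
    (C : ℝ) (hC : 0 < C)
    (hgrad : ∀ x : EuclideanSpace ℝ (Fin 3),
      ‖gradient u x‖ ≤ C * Real.exp (Real.sqrt 2 * x 2))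
    (hlim : ∀ ε : ℝ, 0 < ε → ∃ R : ℝ, 0 < R ∧
      ∀ x : EuclideanSpace ℝ (Fin 3), x 2 ≤ -R → |u x + 1| ≤ ε) :
    ∀ s : ℝ, 0 < s → ∀ A : ℝ,
      MeasureTheory.IntegrableOn
        (fun p : ℝ × ℝ =>
          ‖gradient u (pt p.1 p.2 (-A))‖ ^ 2 / 2
            + (1 - (u (pt p.1 p.2 (-A))) ^ 2) ^ 2 / 4
            - (pd u 2 (pt p.1 p.2 (-A))) ^ 2)
        {p : ℝ × ℝ | p.1 ^ 2 + p.2 ^ 2 < s ^ 2} ∧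
      MeasureTheory.IntegrableOn
        (fun q : ℝ × ℝ =>
          (Real.cos q.2 * pd u 0 (pt (s * Real.cos q.2) (s * Real.sin q.2) q.1)
            + Real.sin q.2 * pd u 1 (pt (s * Real.cos q.2) (s * Real.sin q.2) q.1))
            * pd u 2 (pt (s * Real.cos q.2) (s * Real.sin q.2) q.1))
        (Set.Iio (-A) ×ˢ Set.Ioc 0 (2 * Real.pi)) ∧
      (∫ p in {p : ℝ × ℝ | p.1 ^ 2 + p.2 ^ 2 < s ^ 2},
          (‖gradient u (pt p.1 p.2 (-A))‖ ^ 2 / 2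
            + (1 - (u (pt p.1 p.2 (-A))) ^ 2) ^ 2 / 4
            - (pd u 2 (pt p.1 p.2 (-A))) ^ 2))
        = s * ∫ q in Set.Iio (-A) ×ˢ Set.Ioc 0 (2 * Real.pi),
            (Real.cos q.2 * pd u 0 (pt (s * Real.cos q.2) (s * Real.sin q.2) q.1)
              + Real.sin q.2 * pd u 1 (pt (s * Real.cos q.2) (s * Real.sin q.2) q.1))
              * pd u 2 (pt (s * Real.cos q.2) (s * Real.sin q.2) q.1) := by
  intro s hs A
  have hc := hu.1
  have hg : (fun p : ℝ × ℝ =>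
          ‖gradient u (pt p.1 p.2 (-A))‖ ^ 2 / 2
            + (1 - (u (pt p.1 p.2 (-A))) ^ 2) ^ 2 / 4
            - (pd u 2 (pt p.1 p.2 (-A))) ^ 2) = fun p : ℝ × ℝ => gg u (pt p.1 p.2 (-A)) := by
    ext p
    rw [norm_grad_sq, gg]
    ring
  simp only [hg]
  refine ⟨?_, ?_, ?_⟩
  · have hcont : Continuous (fun p : ℝ × ℝ => gg u (pt p.1 p.2 (-A))) :=
      (contDiff_gg hc).continuous.comp (continuous_pt (by fun_prop) (by fun_prop) (by fun_prop))
    refine (hcont.integrableOn_Icc (a := (-s, -s)) (b := (s, s))).mono_set ?_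
    intro p hp
    simp only [Set.mem_ofPred_eq] at hp
    have h1 : |p.1| ≤ s := abs_le_of_sq_le_sq (by nlinarith [sq_nonneg p.2]) hs.le
    have h2 : |p.2| ≤ s := abs_le_of_sq_le_sq (by nlinarith [sq_nonneg p.1]) hs.le
    rw [abs_le] at h1 h2
    exact ⟨⟨h1.1, h2.1⟩, ⟨h1.2, h2.2⟩⟩
  · exact (integrable_ff hc hgrad s (-A) 0 (2 * Real.pi)).mono_set
      (Set.prod_mono Set.Iio_subset_Iic_self Set.Ioc_subset_Icc_self)
  · change _ = s * ∫ q in Set.Iio (-A) ×ˢ Set.Ioc 0 (2 * Real.pi), ff u s q.1 q.2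
    rw [ff_period hc hgrad, polar_gg u hs]
    have hU : (⋃ n : ℕ, Set.Icc (-A - n) (-A) ×ˢ Set.Icc (-Real.pi) Real.pi)
        = Set.Iic (-A) ×ˢ Set.Icc (-Real.pi) Real.pi := by
      rw [← Set.iUnion_prod_const]
      congr 1
      ext t
      simp only [Set.mem_iUnion, Set.mem_Icc, Set.mem_Iic]
      constructor
      · rintro ⟨n, h⟩
        exact h.2
      · intro h
        obtain ⟨n, hn⟩ := exists_nat_ge (-A - t)
        exact ⟨n, by linarith, h⟩
    have T1 := MeasureTheory.tendsto_setIntegral_of_monotone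
      (μ := (MeasureTheory.volume : MeasureTheory.Measure (ℝ × ℝ)))
      (f := fun q : ℝ × ℝ => ff u s q.1 q.2)
      (s := fun n : ℕ => Set.Icc (-A - n) (-A) ×ˢ Set.Icc (-Real.pi) Real.pi)
      (fun n => measurableSet_Icc.prod measurableSet_Icc)
      (by
        intro n m h
        have : (n : ℝ) ≤ m := by exact_mod_cast h
        exact Set.prod_mono (Set.Icc_subset_Icc (by linarith) le_rfl) le_rfl)
      (by rw [hU]; exact integrable_ff hc hgrad s (-A) _ _)
    rw [hU] at T1
    have hseq : Filter.Tendsto (fun n : ℕ => -A - (n : ℝ)) Filter.atTop Filter.atBot := by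
      simp only [sub_eq_add_neg]
      exact Filter.tendsto_atBot_add_const_left _ _
        (Filter.tendsto_neg_atTop_atBot.comp tendsto_natCast_atTop_atTop)
    have T2 := ((tendsto_int_gg hgrad hlim hs).comp hseq).const_sub
      (∫ p in Set.Icc 0 s ×ˢ Set.Icc (-Real.pi) Real.pi,
        p.1 * gg u (pt (p.1 * Real.cos p.2) (p.1 * Real.sin p.2) (-A)))
    rw [sub_zero] at T2
    refine tendsto_nhds_unique T2 ((T1.const_mul s).congr fun n => ?_)
    have hn : (0 : ℝ) ≤ n := n.cast_nonneg
    exact (box_identity hu hs (by linarith)).symm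
end
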